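/- arXiv:2302.04718 — 2 statements merged into one kernel-verified Lean document; each statement's English description precedes it below -/
import Mathlib

section
/- Let q = 2^h be an even prime power and let S be a set of even type of size q(q+2) in PG(3,q) that is not a hypercylinder. Then there is at most one line ℓ with |ℓ ∩ S| > q/2, and if such a line ℓ exists, then there is a divisor e of h with s = 2^e satisfying 2 < s < q and q + 1 − (q−1)/(s−1) ≤ |ℓ ∩ S| ≤ q − q/s. -/
open Submodule

/-- The points of the projective space `PG(n, K)`: the 1-dimensional
`K`-subspaces of `K^{n+1}`. -/
def PGPoint (K : Type*) [Field K] (n : ℕ) : Type _ :=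
  {W : Submodule K (Fin (n + 1) → K) // Module.finrank K W = 1}

/-- The set of points of `PG(n, K)` lying in a given linear subspace. -/
def pts {K : Type*} [Field K] {n : ℕ} (W : Submodule K (Fin (n + 1) → K)) :
    Set (PGPoint K n) :=
  {P | P.1 ≤ W}

/-- `S` is a `k`-dimensional projective subspace of `PG(n, K)`. -/
def IsKSpace {K : Type*} [Field K] {n : ℕ} (k : ℕ) (S : Set (PGPoint K n)) : Prop :=
  ∃ W : Submodule K (Fin (n + 1) → K), Module.finrank K W = k + 1 ∧ S = pts W

/-- A set of points is of even type if every line meets it in an even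
number of points. -/
def IsEvenType {K : Type*} [Field K] {n : ℕ} (S : Set (PGPoint K n)) : Prop :=
  ∀ L : Set (PGPoint K n), IsKSpace 1 L → Even (S ∩ L).ncard

/-- `O` is a hyperoval in the plane `π`: a set of `q + 2` points of `π`,
no three of which are collinear. -/
def IsHyperovalIn {K : Type*} [Field K] {n : ℕ}
    (π O : Set (PGPoint K n)) : Prop :=
  O ⊆ π ∧ O.ncard = Nat.card K + 2 ∧
    ∀ L : Set (PGPoint K n), IsKSpace 1 L → (O ∩ L).ncard ≤ 2

/-- A hypercylinder in `PG(n, K)`, `n ≥ 3`: the set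
`(⋃_{P ∈ O} ⟨P, τ⟩) \ τ`, where `O` is a hyperoval in a plane `π` and the
vertex `τ` is an `(n-3)`-dimensional projective subspace (linear dimension
`n - 2`) disjoint from `π`.  (For `n = 3` the vertex is a point.) -/
def IsHypercylinder {K : Type*} [Field K] {n : ℕ}
    (S : Set (PGPoint K n)) : Prop :=
  ∃ (Wπ T : Submodule K (Fin (n + 1) → K)) (O : Set (PGPoint K n)),
    Module.finrank K Wπ = 3 ∧ Module.finrank K T = n - 2 ∧ Wπ ⊓ T = ⊥ ∧
    IsHyperovalIn (pts Wπ) O ∧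
    S = {Q : PGPoint K n | (∃ P ∈ O, Q.1 ≤ P.1 ⊔ T) ∧ ¬ Q.1 ≤ T}



namespace EvenAlg
open Polynomial

variable {K : Type*} [Field K]

/-- total degree at most `n` -/
def TD (P : K[X][X]) (n : ℕ) : Prop := ∀ i, P.coeff i ≠ 0 → (P.coeff i).natDegree + i ≤ n

/-- the line polynomial -/
noncomputable def lin (x z : K) : K[X] := C x * X + C z

lemma natDegree_lin (x z : K) : (lin x z).natDegree ≤ 1 := by
  unfold lin; compute_degree

lemma TD_mul_lin (P : K[X][X]) (n : ℕ) (hP : TD P n) (x z : K) :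
    TD (P * (X - C (lin x z))) (n + 1) := by
  intro i hi
  have key : ∀ i, (P.coeff i * lin x z).natDegree + i ≤ n + 1 ∨ P.coeff i = 0 := by
    intro i
    by_cases h : P.coeff i = 0
    · right; exact h
    · left
      have h1 := hP i h
      have h2 := natDegree_mul_le (p := P.coeff i) (q := lin x z)
      have h3 := natDegree_lin x z
      omega
  rw [mul_sub] at hi ⊢
  rw [coeff_sub, coeff_mul_C] at hi ⊢
  cases i with
  | zero =>
    simp only [mul_coeff_zero, coeff_X_zero, mul_zero, zero_sub, natDegree_neg] at hi ⊢
    rcases key 0 with h | h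
    · exact h
    · simp [h] at hi
  | succ i =>
    rw [coeff_mul_X] at hi ⊢
    by_cases h0 : P.coeff i = 0
    · rw [h0, zero_sub] at hi ⊢
      rw [natDegree_neg]
      rcases key (i+1) with h | h
      · exact h
      · simp [h] at hi
    · have h1 := hP i h0
      rcases key (i+1) with h | h
      · have := natDegree_sub_le (P.coeff i) (P.coeff (i + 1) * lin x z)
        have : max (P.coeff i).natDegree (P.coeff (i + 1) * lin x z).natDegree ≤ n - i := by
          apply max_le <;> omega
        omega
      · rw [h, zero_mul, sub_zero]; omega

lemma TD_prod (s : Finset K) (f : K → K) :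
    TD (∏ x ∈ s, (X - C (lin x (f x)))) s.card := by
  classical
  induction s using Finset.induction_on with
  | empty =>
    intro i hi
    simp only [Finset.prod_empty, coeff_one] at hi ⊢
    split_ifs at hi ⊢ with h
    · simp [h]
    · simp at hi
  | insert a s ha ih =>
    rw [Finset.prod_insert ha, Finset.card_insert_of_notMem ha, mul_comm]
    exact TD_mul_lin _ _ ih _ _

variable [Fintype K]

lemma prod_X_sub_C_univ : ∏ a : K, (X - C a) = X ^ Fintype.card K - (X : K[X]) := by
  have h1 := FiniteField.roots_X_pow_card_sub_X K
  have hm : (X ^ Fintype.card K - (X : K[X])).Monic := by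
    apply monic_X_pow_sub
    rw [degree_X]
    exact_mod_cast Fintype.one_lt_card
  have h2 := prod_multiset_X_sub_C_of_monic_of_roots_card_eq hm (by
    rw [h1, FiniteField.X_pow_card_sub_X_natDegree_eq K Fintype.one_lt_card]
    rfl)
  rw [h1] at h2
  exact h2

/-- Rédei polynomial -/
noncomputable def Red (f : K → K) : K[X][X] := ∏ x : K, (X - C (lin x (f x)))

lemma Red_map (f : K → K) (y : K) :
    (Red f).map (evalRingHom y) = ∏ x : K, (X - C (x * y + f x)) := by
  unfold Red lin
  rw [Polynomial.map_prod]
  apply Finset.prod_congr rfl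
  intro x _
  simp

lemma Red_eval (f : K → K) (x : K) : (Red f).eval (lin x (f x)) = 0 := by
  unfold Red
  rw [eval_prod]
  exact Finset.prod_eq_zero (Finset.mem_univ x) (by simp)

lemma Red_monic (f : K → K) : (Red f).Monic := monic_prod_of_monic _ _ (fun _ _ => monic_X_sub_C _)

lemma Red_natDegree (f : K → K) : (Red f).natDegree = Fintype.card K := by
  unfold Red
  rw [natDegree_prod_of_monic _ _ (fun x _ => monic_X_sub_C _)]
  simp

lemma Red_map_bij (f : K → K) (y : K) (h : Function.Bijective (fun x => x * y + f x)) :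
    (Red f).map (evalRingHom y) = X ^ Fintype.card K - X := by
  rw [Red_map, ← prod_X_sub_C_univ]
  exact Function.Bijective.prod_comp h (fun a => X - C a)

lemma Red_map_fiber [DecidableEq K] (f : K → K) (y : K) :
    (Red f).map (evalRingHom y) =
      ∏ v : K, (X - C v) ^ (Finset.univ.filter (fun x => x * y + f x = v)).card := by
  rw [Red_map, ← Finset.prod_fiberwise Finset.univ (fun x => x * y + f x)]
  apply Finset.prod_congr rfl
  intro v _
  rw [← Finset.prod_const]
  apply Finset.prod_congr rfl
  intro x hx
  rw [(Finset.mem_filter.1 hx).2]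

lemma rootMult_Red [DecidableEq K] (f : K → K) (y v : K) :
    ((Red f).map (evalRingHom y)).rootMultiplicity v =
      (Finset.univ.filter (fun x => x * y + f x = v)).card := by
  rw [← count_roots, Red_map]
  have : (∏ x : K, (X - C (x * y + f x))) =
      ((Finset.univ.val.map (fun x : K => x * y + f x)).map (fun a => X - C a)).prod := by
    rw [Multiset.map_map]; rfl
  rw [this, roots_multiset_prod_X_sub_C, Multiset.count_map]
  simp only [Finset.card, Finset.filter_val, eq_comm]

lemma derivative_even [CharP K 2] [DecidableEq K] (f : K → K) (y : K)
    (h : ∀ v, Even (Finset.univ.filter (fun x => x * y + f x = v)).card) :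
    derivative ((Red f).map (evalRingHom y)) = 0 := by
  have : ∃ g : K[X], (Red f).map (evalRingHom y) = g ^ 2 := by
    choose r hr using h
    refine ⟨∏ v : K, (X - C v) ^ (r v), ?_⟩
    rw [Red_map_fiber, ← Finset.prod_pow]
    apply Finset.prod_congr rfl
    intro v _
    rw [← pow_mul, hr v, mul_two]
  obtain ⟨g, hg⟩ := this
  rw [hg, derivative_pow]
  have : (2 : K) = 0 := CharTwo.two_eq_zero
  simp [this]

lemma coeff_odd_of_derivative {A : Type*} [CommRing A] [CharP A 2] (g : A[X])
    (h : derivative g = 0) (i : ℕ) (hi : Odd i) : g.coeff i = 0 := by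
  obtain ⟨j, rfl⟩ := hi
  have := congrArg (fun p => p.coeff (2 * j)) h
  simp only [coeff_derivative, coeff_zero] at this
  have h2 : ((2 * j : ℕ) : A) = 0 := by
    rw [CharP.cast_eq_zero_iff A 2]; exact dvd_mul_right _ _
  push_cast at h2
  rw [Nat.cast_mul, Nat.cast_ofNat, h2] at this
  simpa using this

lemma derivative_of_coeff_odd {A : Type*} [CommRing A] [CharP A 2] (g : A[X])
    (h : ∀ i, Odd i → g.coeff i = 0) : derivative g = 0 := by
  ext i
  rw [coeff_derivative, coeff_zero]
  rcases Nat.even_or_odd (i + 1) with h1 | h1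
  · have : ((i + 1 : ℕ) : A) = 0 := by
      rw [CharP.cast_eq_zero_iff A 2]; exact h1.two_dvd
    push_cast at this
    rw [this, mul_zero]
  · rw [h _ h1, zero_mul]

end EvenAlg


namespace EvenAlg
open Polynomial

variable {K : Type*} [Field K] [Fintype K]

theorem exists_struct [CharP K 2] [DecidableEq K] (f : K → K) (D : Finset K)
    (hq : Even (Fintype.card K))
    (hD : ∀ y, y ∉ D → Function.Bijective (fun x => x * y + f x))
    (hE : ∀ y ∈ D, ∀ v, Even (Finset.univ.filter (fun x => x * y + f x = v)).card) :
    ∃ (Cp : K[X][X]) (A B : K[X]),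
      TD Cp D.card ∧ derivative Cp = 0 ∧
      (∀ x, Cp.eval (lin x (f x)) = derivative B * lin x (f x) - C x * B) ∧
      (∀ y ∈ D, B.eval y = 0 ∧ (derivative B).eval y ≠ 0 ∧
        (Red f).map (evalRingHom y) =
          X ^ Fintype.card K + C (A.eval y) * Cp.map (evalRingHom y)) := by
  have hq2 : 2 ≤ Fintype.card K := Fintype.one_lt_card
  set q := Fintype.card K with hqdef
  set A : K[X] := ∏ y ∈ Dᶜ, (X - C y) with hA
  set B : K[X] := ∏ y ∈ D, (X - C y) with hB
  have hAB : A * B = X ^ q - X := by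
    rw [hqdef, ← prod_X_sub_C_univ, mul_comm, hA, hB, Finset.prod_mul_prod_compl]
  have hAmon : A.Monic := monic_prod_of_monic _ _ (fun _ _ => monic_X_sub_C _)
  have hBmon : B.Monic := monic_prod_of_monic _ _ (fun _ _ => monic_X_sub_C _)
  have hBdeg : B.natDegree = D.card := by
    rw [hB, natDegree_prod_of_monic _ _ (fun _ _ => monic_X_sub_C _)]; simp
  have hAdeg : A.natDegree + D.card = q := by
    have := congrArg natDegree hAB
    rw [hAmon.natDegree_mul hBmon, hBdeg, hqdef,
      FiniteField.X_pow_card_sub_X_natDegree_eq K Fintype.one_lt_card] at this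
    exact this
  have hqK : ((q : ℕ) : K) = 0 := by
    rw [CharP.cast_eq_zero_iff K 2]; exact hq.two_dvd
  have hder : derivative A * B + A * derivative B = -1 := by
    have := congrArg derivative hAB
    rw [derivative_mul, derivative_sub, derivative_X_pow, hqK] at this
    simpa using this
  have hA0 : ∀ y, y ∉ D → A.eval y = 0 := by
    intro y hy
    rw [hA, eval_prod]
    exact Finset.prod_eq_zero (Finset.mem_compl.2 hy) (by simp)
  have hB0 : ∀ y ∈ D, B.eval y = 0 := by
    intro y hy
    rw [hB, eval_prod]
    exact Finset.prod_eq_zero hy (by simp)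
  have hAB1 : ∀ y ∈ D, A.eval y * (derivative B).eval y = -1 := by
    intro y hy
    have := congrArg (eval y) hder
    simpa [hB0 y hy] using this
  set Dif : K[X][X] := Red f - (X ^ q - X) + C (A * derivative B) * X with hDif
  have hmap : ∀ y, Dif.map (evalRingHom y) = (Red f).map (evalRingHom y) - (X ^ q - X)
      + C (A.eval y * (derivative B).eval y) * X := by
    intro y
    simp [hDif]
  have hDif_off : ∀ y, y ∉ D → Dif.map (evalRingHom y) = 0 := by
    intro y hy
    rw [hmap, Red_map_bij f y (hD y hy), hA0 y hy]
    simp [hqdef]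
  have hDif_on : ∀ y ∈ D, Dif.map (evalRingHom y) = (Red f).map (evalRingHom y) - X ^ q := by
    intro y hy
    rw [hmap, hAB1 y hy]
    simp only [map_neg, map_one]
    ring
  have hcoeff_eval : ∀ i y, (Dif.coeff i).eval y = (Dif.map (evalRingHom y)).coeff i := by
    intro i y; rw [coeff_map]; rfl
  have hdvd : C A ∣ Dif := by
    rw [C_dvd_iff_dvd_coeff]
    intro i
    rw [hA]
    apply Finset.prod_dvd_of_coprime
    · intro a _ b _ hab
      exact isCoprime_X_sub_C_of_isUnit_sub (sub_ne_zero.2 hab).isUnit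
    · intro y hy
      rw [dvd_iff_isRoot, IsRoot.def, hcoeff_eval, hDif_off y (Finset.mem_compl.1 hy), coeff_zero]
  obtain ⟨Cp, hCp⟩ := hdvd
  have hTDR : TD (Red f) q := TD_prod Finset.univ f
  have hDc : ∀ i, Dif.coeff i = A * Cp.coeff i := by
    intro i; rw [hCp, coeff_C_mul]
  have hRi : ∀ i, (Red f).coeff i ≠ 0 → ((Red f).coeff i).natDegree + i ≤ q := hTDR
  have hDifi : ∀ i, i ≠ 1 → i ≠ q → Dif.coeff i = (Red f).coeff i := by
    intro i h1 h2
    rw [hDif]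
    simp only [coeff_add, coeff_sub, coeff_X_pow, coeff_C_mul, coeff_X, h2, if_neg (Ne.symm h1)]
    simp
  have hDifq : Dif.coeff q = 0 := by
    have hR : (Red f).coeff q = 1 := by
      have := Red_monic f
      rw [Monic, leadingCoeff, Red_natDegree] at this
      exact this
    rw [hDif]
    have h1 : 1 ≠ q := by omega
    simp only [coeff_add, coeff_sub, coeff_X_pow, coeff_C_mul, coeff_X, if_neg h1, hR]
    simp
  have hdeg1 : (Dif.coeff 1).natDegree < q := by
    have h1 : Dif.coeff 1 = (Red f).coeff 1 + 1 + A * derivative B := by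
      rw [hDif]
      have h1 : 1 ≠ q := by omega
      simp only [coeff_add, coeff_sub, coeff_X_pow, coeff_C_mul, coeff_X, if_neg h1]
      simp
    have h2 : ((Red f).coeff 1).natDegree ≤ q - 1 := by
      by_cases h : (Red f).coeff 1 = 0
      · simp [h]
      · have := hRi 1 h; omega
    have h3 : (A * derivative B).natDegree ≤ q - 1 := by
      by_cases h0 : derivative B = 0
      · simp [h0]
      · have h5 : B.natDegree ≠ 0 := by
          intro h
          rw [eq_C_of_natDegree_eq_zero h] at h0
          simp at h0
        have := natDegree_mul_le (p := A) (q := derivative B)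
        have := natDegree_derivative_lt h5
        omega
    rw [h1]
    have h4 : ((Red f).coeff 1 + 1 + A * derivative B).natDegree ≤ q - 1 := by
      refine natDegree_add_le_of_degree_le (natDegree_add_le_of_degree_le h2 ?_) h3
      simp
    omega
  have hodd : ∀ i, Odd i → Cp.coeff i = 0 := by
    intro i hi
    have : Dif.coeff i = 0 := by
      apply eq_zero_of_natDegree_lt_card_of_eval_eq_zero (Dif.coeff i) (f := (id : K → K))
        Function.injective_id
      · intro y
        rw [id, hcoeff_eval]
        by_cases hy : y ∈ D
        · rw [hDif_on y hy, coeff_sub, coeff_odd_of_derivative _ (derivative_even f y (hE y hy)) i hi,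
            coeff_X_pow, if_neg, sub_zero]
          rintro rfl
          exact (Nat.not_even_iff_odd.2 hi) hq
        · rw [hDif_off y hy, coeff_zero]
      · by_cases h1 : i = 1
        · rw [h1]; exact hdeg1
        · have hiq : i ≠ q := by
            rintro rfl
            exact (Nat.not_even_iff_odd.2 hi) hq
          rw [hDifi i h1 hiq]
          by_cases h : (Red f).coeff i = 0
          · rw [h]; simp; omega
          · have := hRi i h
            have := hi.pos
            omega
    rw [hDc] at this
    exact (mul_eq_zero.1 this).resolve_left hAmon.ne_zero
  refine ⟨Cp, A, B, ?_, derivative_of_coeff_odd _ hodd, ?_, ?_⟩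
  · intro i hi
    have h1 : i ≠ 1 := by rintro rfl; exact hi (hodd 1 odd_one)
    have h2 : i ≠ q := by
      rintro rfl
      rw [hDc] at hDifq
      exact hi ((mul_eq_zero.1 hDifq).resolve_left hAmon.ne_zero)
    have h3 := hDc i
    rw [hDifi i h1 h2] at h3
    have h4 : (Red f).coeff i ≠ 0 := by
      rw [h3]; exact mul_ne_zero hAmon.ne_zero hi
    have h5 := hRi i h4
    rw [h3, hAmon.natDegree_mul' hi] at h5
    omega
  · intro x
    have h1 : Dif.eval (lin x (f x)) = A * Cp.eval (lin x (f x)) := by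
      rw [hCp]; simp
    have h2 : (lin x (f x)) ^ q = C x * X ^ q + C (f x) := by
      obtain ⟨n, _, hn⟩ := FiniteField.card K 2
      have hx := FiniteField.pow_card x
      have hf := FiniteField.pow_card (f x)
      unfold lin
      rw [← hqdef] at hn hx hf
      rw [hn] at hx hf ⊢
      rw [add_pow_char_pow, mul_pow, ← C_pow, ← C_pow, hx, hf]
    have h3 : Dif.eval (lin x (f x)) = A * (derivative B * lin x (f x) - C x * B) := by
      rw [hDif]
      simp only [eval_add, eval_sub, Red_eval, eval_pow, eval_X, eval_mul, eval_C, h2]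
      have : lin x (f x) = C x * X + C (f x) := rfl
      rw [this]
      linear_combination (C x) * hAB
    exact mul_left_cancel₀ hAmon.ne_zero (h1.symm.trans h3)
  · intro y hy
    refine ⟨hB0 y hy, ?_, ?_⟩
    · intro h
      have := hAB1 y hy
      rw [h] at this
      simp at this
    · have := hDif_on y hy
      rw [hCp] at this
      simp only [Polynomial.map_mul, map_C, coe_evalRingHom] at this
      rw [this]; ring

end EvenAlg


namespace EvenAlg
open Polynomial

lemma exists_expand {A : Type*} [CommRing A] [IsDomain A] [CharP A 2] (n : ℕ) :
    ∀ P : A[X], P.natDegree ≤ n → P.natDegree ≠ 0 →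
    ∃ (e : ℕ) (G : A[X]), P = expand A (2 ^ e) G ∧ derivative G ≠ 0 := by
  induction n with
  | zero => intro P h1 h2; omega
  | succ n ih =>
    intro P h1 h2
    by_cases hd : derivative P = 0
    · have h3 := expand_contract 2 hd (by norm_num)
      have h4 := natDegree_expand 2 (contract 2 P)
      rw [h3] at h4
      obtain ⟨e, G, hG, hG'⟩ := ih (contract 2 P) (by omega) (by omega)
      refine ⟨e + 1, G, ?_, hG'⟩
      rw [← h3, hG, expand_expand, pow_succ']
    · exact ⟨0, P, by simp, hd⟩

variable {K : Type*} [Field K] [Fintype K]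

lemma dvd_of_roots [CharP K 2] (h e : ℕ) (hK : Fintype.card K = 2 ^ h) (he : 1 ≤ e)
    (F : Finset K) (hF : 2 ^ e ≤ F.card) (α a b : K) (hα : α ≠ 0)
    (hroot : ∀ x ∈ F, α * x ^ (2 ^ e) = a + b * x) : e ∣ h := by
  classical
  have hs : 2 ≤ 2 ^ e := by
    calc 2 = 2 ^ 1 := rfl
      _ ≤ 2 ^ e := Nat.pow_le_pow_right (by norm_num) he
  obtain ⟨x0, hx0, x1, hx1, hne⟩ := Finset.one_lt_card.1 (lt_of_lt_of_le (by omega) hF)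
  set w := x1 - x0 with hw
  have hw0 : w ≠ 0 := sub_ne_zero.2 hne.symm
  have hlin : ∀ x ∈ F, α * (x - x0) ^ (2 ^ e) = b * (x - x0) := by
    intro x hx
    rw [sub_pow_char_pow, mul_sub, hroot x hx, hroot x0 hx0]; ring
  have hz : ∀ x ∈ F, ((x - x0) / w) ^ (2 ^ e) = (x - x0) / w := by
    intro x hx
    have h1 := hlin x hx
    have h2 := hlin x1 hx1
    rw [← hw] at h2
    rw [div_pow, div_eq_div_iff (pow_ne_zero _ hw0) hw0]
    apply mul_left_cancel₀ hα
    linear_combination w * h1 - (x - x0) * h2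
  set g := Nat.gcd (2 ^ e - 1) (2 ^ h - 1) with hg
  have hgpos : 0 < g := Nat.gcd_pos_of_pos_left _ (by omega)
  have hsub : (F.erase x0).image (fun x => (x - x0) / w) ⊆ (nthRoots g (1 : K)).toFinset := by
    intro z hz'
    obtain ⟨x, hx, rfl⟩ := Finset.mem_image.1 hz'
    obtain ⟨hx0', hxF⟩ := Finset.mem_erase.1 hx
    rw [Multiset.mem_toFinset, mem_nthRoots hgpos]
    set z := (x - x0) / w
    have hz0 : z ≠ 0 := div_ne_zero (sub_ne_zero.2 hx0') hw0
    rw [hg]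
    apply pow_gcd_eq_one.2
    constructor
    · have := hz x hxF
      apply mul_right_cancel₀ hz0
      rw [← pow_succ, one_mul, Nat.sub_add_cancel (by omega)]
      exact this
    · rw [← hK]; exact FiniteField.pow_card_sub_one_eq_one z hz0
  have hcard := Finset.card_le_card hsub
  rw [Finset.card_image_of_injective, Finset.card_erase_of_mem hx0] at hcard
  · have h1 := Multiset.toFinset_card_le (nthRoots g (1 : K))
    have h2 := card_nthRoots g (1 : K)
    rw [Nat.pow_sub_one_gcd_pow_sub_one] at hg
    have hle : 2 ^ e ≤ 2 ^ (Nat.gcd e h) := by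
      have : 0 < 2 ^ (Nat.gcd e h) := by positivity
      omega
    have h3 := (Nat.pow_le_pow_iff_right (by norm_num)).1 hle
    have h4 : Nat.gcd e h = e := le_antisymm (Nat.le_of_dvd (by omega) (Nat.gcd_dvd_left e h)) h3
    rw [← h4]; exact Nat.gcd_dvd_right e h
  · intro u v huv
    simpa [div_left_inj' hw0] using huv

/-- The local analysis at a point. -/
lemma local_lemma {K : Type*} [Field K] (s : ℕ) (hs : 2 ≤ s) (G : K[X][X]) (a b : K[X]) (F : Finset K)
    (hF : s ≤ F.card)
    (hG : ∀ x ∈ F, G.eval (C (x ^ s) * X ^ s) = a + C x * b) :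
    (∀ j, 1 ≤ j → X ^ F.card ∣ G.coeff j * X ^ (s * j)) ∧
    ∃ a' b' : K, ∀ x ∈ F, (G.coeff 1).eval 0 * x ^ s = a' + b' * x := by
  have hexp : ∀ n, ∀ x ∈ F, ∑ j ∈ Finset.range (G.natDegree + 1),
      (G.coeff j * X ^ (s * j)).coeff n * x ^ (s * j) = a.coeff n + x * b.coeff n := by
    intro n x hx
    have := congrArg (fun p => p.coeff n) (hG x hx)
    simp only [eval_eq_sum_range, finsetSum_coeff, coeff_add, coeff_C_mul] at this
    rw [← this]
    apply Finset.sum_congr rfl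
    intro j _
    rw [mul_pow, ← C_pow, ← pow_mul, ← pow_mul, mul_comm (C _), ← mul_assoc, coeff_mul_C]
  constructor
  · intro j hj
    rw [X_pow_dvd_iff]
    intro n hn
    by_cases hjd : G.natDegree < j
    · rw [coeff_eq_zero_of_natDegree_lt hjd]; simp
    set p : K[X] := ∑ j ∈ Finset.range (G.natDegree + 1),
      C ((G.coeff j * X ^ (s * j)).coeff n) * X ^ (s * j) - C (a.coeff n) - C (b.coeff n) * X with hp
    have hp0 : p = 0 := by
      apply eq_zero_of_natDegree_lt_card_of_eval_eq_zero' p F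
      · intro x hx
        rw [hp]
        simp only [eval_sub, eval_finsetSum, eval_mul, eval_C, eval_pow, eval_X, hexp n x hx]
        ring
      · have : p.natDegree ≤ F.card - 1 := by
          rw [hp]
          refine (natDegree_sub_le _ _).trans (max_le ((natDegree_sub_le _ _).trans (max_le ?_ ?_)) ?_)
          · apply natDegree_sum_le_of_forall_le
            intro i _
            by_cases hi : s * i ≤ n
            · refine (natDegree_C_mul_X_pow_le _ _).trans ?_
              omega
            · rw [coeff_mul_X_pow', if_neg hi]; simp
          · simp
          · have h7 : (C (b.coeff n) * X : K[X]).natDegree ≤ 1 := by compute_degree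
            omega
        omega
    have h1 := congrArg (fun r => r.coeff (s * j)) hp0
    have hsj : 2 ≤ s * j := by nlinarith
    simp only [hp, coeff_sub, finsetSum_coeff, coeff_C_mul, coeff_X_pow, coeff_zero, coeff_C,
      coeff_X] at h1
    rw [Finset.sum_eq_single j] at h1
    · rw [if_neg (by omega : ¬ s * j = 0), if_neg (by omega : ¬ 1 = s * j)] at h1
      simpa using h1
    · intro i _ hij
      rw [if_neg, mul_zero]
      intro h
      exact hij (Nat.eq_of_mul_eq_mul_left (by omega) h).symm
    · intro h
      exact absurd (Finset.mem_range.2 (by omega)) h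
  · refine ⟨a.coeff s - (G.coeff 0).coeff s, b.coeff s, ?_⟩
    intro x hx
    have h1 := hexp s x hx
    have h2 : ∀ j, (G.coeff j * X ^ (s * j)).coeff s * x ^ (s * j) =
        if j = 0 then (G.coeff 0).coeff s else
          if j = 1 then (G.coeff 1).coeff 0 * x ^ s else 0 := by
      intro j
      rw [coeff_mul_X_pow']
      rcases j with _ | _ | j
      · simp
      · simp
      · rw [if_neg, if_neg, if_neg, zero_mul] <;> try omega
        nlinarith
    simp only [h2] at h1
    rw [← coeff_zero_eq_eval_zero]
    have h3 : ∑ j ∈ Finset.range (G.natDegree + 1), (if j = 0 then (G.coeff 0).coeff s else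
          if j = 1 then (G.coeff 1).coeff 0 * x ^ s else 0) =
          (G.coeff 0).coeff s + (G.coeff 1).coeff 0 * x ^ s := by
      rw [Finset.sum_range_succ']
      simp only [Nat.add_eq_zero_iff, one_ne_zero, and_false, if_false, if_true,
        Nat.add_eq_right]
      rw [Finset.sum_ite_eq' (Finset.range G.natDegree) 0]
      split_ifs with h
      · ring
      · rw [coeff_eq_zero_of_natDegree_lt (p := G) (n := 1)]
        · simp
        · simp at h; omega
    rw [h3] at h1
    linear_combination h1

end EvenAlg


namespace EvenAlg
open Polynomial

variable {K : Type*} [Field K] [Fintype K]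

lemma sum_fibers [DecidableEq K] (f : K → K) (D : Finset K)
    (hD : ∀ y, y ∉ D → Function.Bijective (fun x => x * y + f x)) (x : K) :
    ∑ y ∈ D, ((Finset.univ.filter (fun x' => x' * y + f x' = x * y + f x)).card - 1)
      = Fintype.card K - 1 := by
  have h1 : ∀ y, (Finset.univ.filter (fun x' => x' * y + f x' = x * y + f x)).card - 1
      = ((Finset.univ.erase x).filter (fun x' => (f x - f x') / (x' - x) = y)).card := by
    intro y
    rw [← Finset.card_erase_of_mem (a := x) (by simp)]
    congr 1
    ext x'
    simp only [Finset.mem_erase, Finset.mem_filter, Finset.mem_univ, true_and, and_true]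
    apply and_congr_right
    intro hne
    have : x' - x ≠ 0 := sub_ne_zero.2 hne
    rw [div_eq_iff this]
    constructor
    · intro h; linear_combination -h
    · intro h; linear_combination -h
  rw [Finset.sum_congr rfl (fun y _ => h1 y), ← Finset.card_eq_sum_card_fiberwise,
    Finset.card_erase_of_mem (Finset.mem_univ x), Finset.card_univ]
  intro x' hx'
  have hne : x' ≠ x := by simpa using hx'
  have : x' - x ≠ 0 := sub_ne_zero.2 hne
  by_contra hy
  have hinj := (hD _ hy).1
  apply hne
  apply hinj
  simp only
  field_simp
  ring

theorem planar [CharP K 2] [DecidableEq K] (h : ℕ) (hK : Fintype.card K = 2 ^ h)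
    (f : K → K) (D : Finset K)
    (hD : ∀ y, y ∉ D → Function.Bijective (fun x => x * y + f x))
    (hE : ∀ y ∈ D, ∀ v, Even (Finset.univ.filter (fun x => x * y + f x = v)).card)
    (hN : 2 ≤ D.card) :
    ∃ e, e ∣ h ∧ 1 ≤ e ∧ 2 ^ e < Fintype.card K ∧
      Fintype.card K / 2 ^ e + 1 ≤ D.card ∧ D.card * (2 ^ e - 1) ≤ Fintype.card K - 1 := by
  have hq1 : 1 < Fintype.card K := Fintype.one_lt_card
  have hh : 1 ≤ h := by
    by_contra hc
    have : h = 0 := by omega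
    rw [this] at hK; omega
  have hqe : Even (Fintype.card K) := by
    rw [hK]; exact (Nat.even_pow.2 ⟨even_two, by omega⟩)
  obtain ⟨Cp, A, B, hTD, hder, hev, hDy⟩ := exists_struct f D hqe hD hE
  have hDq : D.card ≤ Fintype.card K := Finset.card_le_univ D
  -- `Cp` is not constant in `X`
  have hCp0 : Cp.natDegree ≠ 0 := by
    intro h0
    obtain ⟨y1, hy1, y2, hy2, hne⟩ := Finset.one_lt_card.1 (lt_of_lt_of_le (by norm_num) hN)
    have key : ∀ y ∈ D, (1 : K) * y + f 1 = f 0 := by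
      intro y hy
      have e1 := hev 1
      have e0 := hev 0
      rw [eq_C_of_natDegree_eq_zero h0, eval_C] at e1 e0
      have e2 := congrArg (eval y) (e1.symm.trans e0)
      obtain ⟨hB0, hB1, -⟩ := hDy y hy
      simp only [lin, eval_sub, eval_mul, eval_add, eval_C, eval_X, hB0, mul_zero, sub_zero,
        zero_mul, zero_add] at e2
      exact mul_left_cancel₀ hB1 e2
    apply hne
    linear_combination key y1 hy1 - key y2 hy2
  obtain ⟨e, G, hG, hG'⟩ := exists_expand _ Cp le_rfl hCp0
  have he1 : 1 ≤ e := by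
    by_contra hc
    have : e = 0 := by omega
    rw [this] at hG
    simp only [pow_zero, expand_one] at hG
    rw [hG] at hder
    exact hG' hder
  set s := 2 ^ e with hsdef
  have hs2 : 2 ≤ s := by
    calc 2 = 2 ^ 1 := rfl
      _ ≤ 2 ^ e := Nat.pow_le_pow_right (by norm_num) he1
  have hGc : ∀ j, G.coeff j ≠ 0 → (G.coeff j).natDegree + s * j ≤ D.card := by
    intro j hj
    have h1 := hTD (s * j)
    rw [hG, coeff_expand_mul' (by omega)] at h1
    exact h1 hj
  -- `s ≤ N`
  have hsN : s ≤ D.card := by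
    by_contra hc
    apply hG'
    ext1 j
    rw [coeff_derivative, coeff_zero]
    by_cases hj : G.coeff (j + 1) = 0
    · rw [hj, zero_mul]
    · have h1 := hGc _ hj
      rw [mul_add, mul_one] at h1
      omega
  have hsq : s ∣ Fintype.card K := by
    rw [hK, hsdef]
    apply pow_dvd_pow
    have : 2 ^ e ≤ 2 ^ h := by rw [← hK, ← hsdef]; omega
    exact (Nat.pow_le_pow_iff_right (by norm_num)).1 this
  obtain ⟨r, hr⟩ := hsq
  let k : K → K → ℕ := fun x y =>
    (Finset.univ.filter (fun x' => x' * y + f x' = x * y + f x)).card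
  have hkpos : ∀ x y, 1 ≤ k x y := by
    intro x y
    apply Finset.card_pos.2
    exact ⟨x, by simp⟩
  have hsk : ∀ x, ∀ y ∈ D, s ∣ k x y := by
    intro x y hy
    have h1 := rootMult_Red f y (x * y + f x)
    have h2 := (hDy y hy).2.2
    have h3 : (Red f).map (evalRingHom y) =
        expand K (2 ^ e) (X ^ r + C (A.eval y) * G.map (evalRingHom y)) := by
      rw [h2, hG, hr, hsdef]
      simp only [map_add, map_mul, map_pow, expand_X, expand_C, map_expand, ← pow_mul]
    rw [h3, rootMultiplicity_expand_pow] at h1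
    exact ⟨_, h1.symm⟩
  have hks : ∀ x, ∀ y ∈ D, s ≤ k x y := fun x y hy =>
    Nat.le_of_dvd (hkpos x y) (hsk x y hy)
  let E : K → K[X] := fun x => (derivative G).eval ((lin x (f x)) ^ s)
  -- local analysis
  have hloc : ∀ x, ∀ y ∈ D, (X - C y) ^ (k x y - s) ∣ E x ∧
      ((E x).eval y ≠ 0 → e ∣ h) := by
    intro x y hy
    set φ : K[X] →+* K[X] := (taylorAlgHom y : K[X] →ₐ[K] K[X]).toRingHom with hφ
    have hφX : φ X = X + C y := by simp [hφ]
    have hφC : ∀ a, φ (C a) = C a := by intro a; simp [hφ]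
    have hφt : ∀ p, φ p = p.comp (X + C y) := by intro p; simp [hφ, taylor_apply]
    set X0 := x * y + f x with hX0
    set F := Finset.univ.filter (fun x' => x' * y + f x' = X0) with hF
    have hFk : F.card = k x y := rfl
    set g := (G.map φ).comp (X + C (C (X0 ^ s))) with hg
    have hlin : ∀ x' ∈ F, φ (lin x' (f x')) = C x' * X + C X0 := by
      intro x' hx'
      have : x' * y + f x' = X0 := by simpa [hF] using hx'
      simp only [lin, map_add, map_mul, hφX, hφC]
      rw [← this]
      simp only [map_add, map_mul]
      ring
    have hpow : ∀ x' : K, (C x' * X + C X0) ^ s = C (x' ^ s) * X ^ s + C (X0 ^ s) := by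
      intro x'
      rw [hsdef, add_pow_char_pow, mul_pow, ← C_pow, ← C_pow]
    have hgen : ∀ P : K[X][X], ∀ x' ∈ F, φ (P.eval ((lin x' (f x')) ^ s)) =
        ((P.map φ).comp (X + C (C (X0 ^ s)))).eval (C (x' ^ s) * X ^ s) := by
      intro P x' hx'
      rw [eval_comp, ← eval_map_apply, map_pow, hlin x' hx', hpow]
      simp
    obtain ⟨l1, a', b', l2⟩ := local_lemma s hs2 g (φ (derivative B) * C X0)
      (φ (derivative B) * X - φ B) F (by rw [hFk]; exact hks x y hy) (by
        intro x' hx'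
        rw [hg, ← hgen G x' hx', ← expand_eval, hsdef, ← hG, hev, map_sub, map_mul, map_mul,
          hlin x' hx', hφC]
        ring)
    have hxF : x ∈ F := by simp [hF, hX0]
    have hgd : derivative g = ((derivative G).map φ).comp (X + C (C (X0 ^ s))) := by
      rw [hg, derivative_comp, derivative_add, derivative_X, derivative_C, add_zero, one_mul,
        derivative_map]
    have hφE : φ (E x) = (derivative g).eval (C (x ^ s) * X ^ s) := by
      rw [hgd]; exact hgen (derivative G) x hxF
    constructor
    · have hXs : X ^ F.card ∣ X ^ s * φ (E x) := by
        rw [hφE, eval_eq_sum_range, Finset.mul_sum]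
        apply Finset.dvd_sum
        intro j _
        rw [coeff_derivative]
        have := l1 (j + 1) (by omega)
        refine this.trans ⟨((j : K[X]) + 1) * C (x ^ s) ^ j, ?_⟩
        rw [mul_pow, ← pow_mul]
        ring
      have hX : X ^ (k x y - s) ∣ φ (E x) := by
        rw [hFk, ← Nat.add_sub_cancel' (hks x y hy), pow_add] at hXs
        exact (mul_dvd_mul_iff_left (pow_ne_zero _ X_ne_zero)).1 hXs
      obtain ⟨m, hm⟩ := hX
      refine ⟨m.comp (X - C y), ?_⟩
      have h5 := congrArg (fun p => p.comp (X - C y)) hm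
      simp only [hφt, comp_assoc, mul_comp, pow_comp, X_comp] at h5
      simpa using h5
    · intro hne
      apply dvd_of_roots h e hK he1 F (by rw [hFk]; exact hks x y hy) ((g.coeff 1).eval 0) a' b' _ l2
      have h6 : (E x).eval y = (φ (E x)).eval 0 := by rw [hφt]; simp
      rw [h6, hφE] at hne
      intro h7
      apply hne
      rw [← coe_evalRingHom, ← eval_map_apply]
      simp only [coe_evalRingHom, eval_mul, eval_C, eval_pow, eval_X]
      rw [zero_pow (by omega), mul_zero, ← coeff_zero_eq_eval_zero, coeff_map, coeff_derivative]
      simpa using h7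
  -- degree of E
  have hEdeg : ∀ x, (E x).natDegree ≤ D.card - s := by
    intro x
    simp only [E, eval_eq_sum_range]
    apply natDegree_sum_le_of_forall_le
    intro j _
    rw [coeff_derivative]
    by_cases hj : G.coeff (j + 1) = 0
    · simp [hj]
    have h1 := hGc _ hj
    rw [mul_add, mul_one] at h1
    have h2 : (((j : K[X]) + 1)).natDegree = 0 := by
      rw [← Nat.cast_one, ← Nat.cast_add]; exact natDegree_natCast _
    have h3 : ((lin x (f x) ^ s) ^ j).natDegree ≤ s * j := by
      rw [← pow_mul]
      refine natDegree_pow_le.trans ?_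
      exact (Nat.mul_le_mul_left _ (natDegree_lin x (f x))).trans (by simp)
    have h4 := natDegree_mul_le (p := G.coeff (j + 1) * ((j : K[X]) + 1))
      (q := (lin x (f x) ^ s) ^ j)
    have h5 := natDegree_mul_le (p := G.coeff (j + 1)) (q := (j : K[X]) + 1)
    omega
  -- some E x is nonzero
  have hEx : ∃ x, E x ≠ 0 := by
    by_contra hc
    push Not at hc
    apply hG'
    have : expand K[X] s (derivative G) = 0 := by
      apply eq_zero_of_natDegree_lt_card_of_eval_eq_zero _ (f := fun x : K => lin x (f x))
      · intro x x' hxx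
        have := congrArg (fun p => p.coeff 1) hxx
        simpa [lin] using this
      · intro x
        rw [expand_eval]; exact hc x
      · rw [natDegree_expand]
        have h1 : (derivative G).coeff (derivative G).natDegree ≠ 0 := by
          rw [coeff_natDegree, leadingCoeff_ne_zero]; exact hG'
        set j := (derivative G).natDegree
        rw [coeff_derivative] at h1
        have h2 := hGc (j + 1) (left_ne_zero_of_mul h1)
        rw [mul_add, mul_one] at h2
        have := mul_comm s j
        omega
    exact (expand_eq_zero (by omega)).1 this
  obtain ⟨x, hx⟩ := hEx
  have hsum := sum_fibers f D hD x
  have hsum' : ∑ y ∈ D, (k x y - 1) = Fintype.card K - 1 := hsum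
  have hsumk : ∑ y ∈ D, k x y = Fintype.card K - 1 + D.card := by
    rw [← hsum', Finset.card_eq_sum_ones, ← Finset.sum_add_distrib]
    apply Finset.sum_congr rfl
    intro y _
    have := hkpos x y
    omega
  have hmult : ∑ y ∈ D, (k x y - s) ≤ D.card - s := by
    have hd : ∏ y ∈ D, (X - C y) ^ (k x y - s) ∣ E x := by
      apply Finset.prod_dvd_of_coprime
      · intro a _ b _ hab
        exact (isCoprime_X_sub_C_of_isUnit_sub (sub_ne_zero.2 hab).isUnit).pow
      · intro y hy
        exact (hloc x y hy).1
    have h1 := natDegree_le_of_dvd hd hx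
    rw [natDegree_prod_of_monic _ _ (fun y _ => (monic_X_sub_C y).pow _)] at h1
    simp only [natDegree_pow, natDegree_X_sub_C, mul_one] at h1
    exact h1.trans (hEdeg x)
  have hsums : ∑ y ∈ D, (k x y - s) + s * D.card = Fintype.card K - 1 + D.card := by
    rw [← hsumk, mul_comm, ← smul_eq_mul, ← Finset.sum_const, ← Finset.sum_add_distrib]
    apply Finset.sum_congr rfl
    intro y hy
    have := hks x y hy
    omega
  have hNs : D.card * (s - 1) ≤ Fintype.card K - 1 := by
    rw [← hsum', ← smul_eq_mul, ← Finset.sum_const]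
    apply Finset.sum_le_sum
    intro y hy
    have := hks x y hy
    omega
  have hlow : Fintype.card K / s + 1 ≤ D.card := by
    rw [hr, Nat.mul_div_cancel_left _ (by omega)]
    by_contra hc
    have h1 : D.card ≤ r := by omega
    have h2 : s * D.card ≤ s * r := Nat.mul_le_mul_left _ h1
    omega
  refine ⟨e, ?_, he1, ?_, hlow, hNs⟩
  · have : ∃ y ∈ D, (E x).eval y ≠ 0 := by
      by_contra hc
      push Not at hc
      apply hx
      apply eq_zero_of_natDegree_lt_card_of_eval_eq_zero' (E x) D hc
      have := hEdeg x
      omega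
    obtain ⟨y, hy, hyE⟩ := this
    exact (hloc x y hy).2 hyE
  · by_contra hc
    have h1 : Fintype.card K - 1 ≤ s - 1 := by omega
    have h2 : 2 * (s - 1) ≤ D.card * (s - 1) := Nat.mul_le_mul_right _ hN
    omega

end EvenAlg


set_option linter.unusedSectionVars false
set_option linter.deprecated false

/-- underlying subspace of a point -/
def PGPoint.sp {K : Type*} [Field K] (P : PGPoint K 3) : Submodule K (Fin (3 + 1) → K) := P.1

namespace EvenGeo
open Module

variable {K : Type*} [Field K] [Finite K]

/-- the ambient vector space -/
abbrev V (K : Type*) := Fin (3 + 1) → K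

lemma sp_inj {P Q : PGPoint K 3} (h : P.sp = Q.sp) : P = Q := Subtype.ext h

lemma sp_finrank (P : PGPoint K 3) : finrank K P.sp = 1 := P.2

lemma mem_pts {P : PGPoint K 3} {W : Submodule K (V K)} : P ∈ pts W ↔ P.sp ≤ W := Iff.rfl

instance : Finite (PGPoint K 3) := by unfold PGPoint; infer_instance

/-- number of points of `S` in `W` -/
noncomputable def cnt (S : Set (PGPoint K 3)) (W : Submodule K (V K)) : ℕ := (S ∩ pts W).ncard

/-- subspaces of `B` that cover `A` -/
noncomputable def Pen (A B : Submodule K (V K)) : Finset (Submodule K (V K)) :=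
  (Set.toFinite {M | A ≤ M ∧ M ≤ B ∧ finrank K M = finrank K A + 1}).toFinset

lemma mem_Pen {A B M : Submodule K (V K)} :
    M ∈ Pen A B ↔ A ≤ M ∧ M ≤ B ∧ finrank K M = finrank K A + 1 := by
  simp [Pen]

lemma eq_of_le_pt {P Q : PGPoint K 3} (h : P.sp ≤ Q.sp) : P = Q :=
  sp_inj (Submodule.eq_of_le_of_finrank_eq h ((sp_finrank P).trans (sp_finrank Q).symm))

lemma inf_pt (A : Submodule K (V K)) (P : PGPoint K 3) (h : ¬ P.sp ≤ A) : A ⊓ P.sp = ⊥ := by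
  by_contra hc
  have h1 : finrank K (A ⊓ P.sp : Submodule K (V K)) ≠ 0 := by
    intro h0; exact hc (Submodule.finrank_eq_zero.1 h0)
  have h2 := Submodule.finrank_mono (inf_le_right : A ⊓ P.sp ≤ P.sp)
  have h4 : finrank K P.sp = 1 := sp_finrank P
  have h3 : A ⊓ P.sp = P.sp := Submodule.eq_of_le_of_finrank_le inf_le_right
    (by rw [sp_finrank P]; exact Nat.one_le_iff_ne_zero.2 h1)
  exact h (inf_eq_right.1 h3)

lemma finrank_sup_pt (A : Submodule K (V K)) (P : PGPoint K 3) (h : ¬ P.sp ≤ A) :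
    finrank K (A ⊔ P.sp : Submodule K (V K)) = finrank K A + 1 := by
  have h1 := Submodule.finrank_sup_add_finrank_inf_eq A P.sp
  rw [inf_pt A P h, finrank_bot, sp_finrank P] at h1
  exact h1

lemma pen_eq {A B M : Submodule K (V K)} (hM : M ∈ Pen A B) (P : PGPoint K 3) (h : ¬ P.sp ≤ A)
    (hP : P.sp ≤ M) : A ⊔ P.sp = M := by
  obtain ⟨h1, h2, h3⟩ := mem_Pen.1 hM
  exact Submodule.eq_of_le_of_finrank_eq (sup_le h1 hP) (by rw [finrank_sup_pt A P h, h3])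

lemma partition (S : Set (PGPoint K 3)) (A B : Submodule K (V K)) (hAB : A ≤ B) :
    cnt S B = cnt S A + ∑ M ∈ Pen A B, ((S ∩ pts M) \ pts A).ncard := by
  classical
  have hfin : ∀ T : Set (PGPoint K 3), T.Finite := fun T => Set.toFinite T
  have h1 : cnt S B = cnt S A + ((S ∩ pts B) \ pts A).ncard := by
    unfold cnt
    have : S ∩ pts A = (S ∩ pts B) ∩ pts A := by
      ext P
      simp only [Set.mem_inter_iff, mem_pts]
      exact ⟨fun h => ⟨⟨h.1, h.2.trans hAB⟩, h.2⟩, fun h => ⟨h.1.1, h.2⟩⟩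
    rw [this]
    exact (Set.ncard_inter_add_ncard_sdiff_eq_ncard _ _ (hfin _)).symm
  rw [h1]
  congr 1
  rw [Set.ncard_eq_toFinset_card _ (hfin _),
    Finset.card_eq_sum_card_fiberwise (f := fun P : PGPoint K 3 => A ⊔ P.sp) (t := Pen A B)]
  · apply Finset.sum_congr rfl
    intro M hM
    rw [Set.ncard_eq_toFinset_card _ (hfin _)]
    congr 1
    ext P
    simp only [Finset.mem_filter, Set.Finite.mem_toFinset, Set.mem_diff, Set.mem_inter_iff, mem_pts]
    constructor
    · rintro ⟨⟨⟨h1, h2⟩, h3⟩, h4⟩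
      exact ⟨⟨h1, h4 ▸ le_sup_right⟩, h3⟩
    · rintro ⟨⟨h1, h2⟩, h3⟩
      exact ⟨⟨⟨h1, h2.trans (mem_Pen.1 hM).2.1⟩, h3⟩, pen_eq hM P h3 h2⟩
  · intro P hP
    simp only [Set.Finite.coe_toFinset, Set.mem_diff, Set.mem_inter_iff, mem_pts] at hP
    exact mem_Pen.2 ⟨le_sup_left, sup_le hAB hP.1.2, finrank_sup_pt A P hP.2⟩

lemma cnt_diff (S : Set (PGPoint K 3)) (A M : Submodule K (V K)) (hAM : A ≤ M) :
    ((S ∩ pts M) \ pts A).ncard + cnt S A = cnt S M := by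
  unfold cnt
  have : S ∩ pts A = (S ∩ pts M) ∩ pts A := by
    ext P
    simp only [Set.mem_inter_iff, mem_pts]
    exact ⟨fun h => ⟨⟨h.1, h.2.trans hAM⟩, h.2⟩, fun h => ⟨h.1.1, h.2⟩⟩
  rw [this, add_comm]
  exact Set.ncard_inter_add_ncard_sdiff_eq_ncard _ _ (Set.toFinite _)

lemma partition' (S : Set (PGPoint K 3)) (A B : Submodule K (V K)) (hAB : A ≤ B) :
    cnt S B + (Pen A B).card * cnt S A = cnt S A + ∑ M ∈ Pen A B, cnt S M := by
  rw [partition S A B hAB, ← smul_eq_mul, ← Finset.sum_const, add_assoc, ← Finset.sum_add_distrib]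
  congr 1
  apply Finset.sum_congr rfl
  intro M hM
  exact cnt_diff S A M (mem_Pen.1 hM).1

/-- point spanned by a vector -/
noncomputable def pt (v : V K) (hv : v ≠ 0) : PGPoint K 3 := ⟨span K {v}, finrank_span_singleton hv⟩

lemma sp_pt (v : V K) (hv : v ≠ 0) : (pt v hv).sp = span K {v} := rfl

lemma exists_pt (P : PGPoint K 3) : ∃ v : V K, v ≠ 0 ∧ P.sp = span K {v} := by
  obtain ⟨v, hv⟩ := finrank_eq_one_iff'.1 (sp_finrank P)
  refine ⟨v.1, fun h => hv.1 (Subtype.ext h), ?_⟩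
  apply le_antisymm
  · intro w hw
    obtain ⟨c, hc⟩ := hv.2 ⟨w, hw⟩
    rw [mem_span_singleton]
    exact ⟨c, congrArg Subtype.val hc⟩
  · rw [span_singleton_le_iff_mem]; exact v.2

lemma card_nonzero (W : Submodule K (V K)) :
    ({v : V K | v ∈ W ∧ v ≠ 0}).ncard + 1 = Nat.card K ^ finrank K W := by
  rw [← Module.natCard_eq_pow_finrank (K := K) (V := W)]
  have h0 : (0 : V K) ∉ {v : V K | v ∈ W ∧ v ≠ 0} := by simp
  rw [← Set.ncard_insert_of_notMem h0 (Set.toFinite _)]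
  have : insert (0 : V K) {v : V K | v ∈ W ∧ v ≠ 0} = (W : Set (V K)) := by
    ext v
    simp only [Set.mem_insert_iff, Set.mem_setOf_eq, SetLike.mem_coe]
    by_cases hv : v = 0
    · simp [hv]
    · simp [hv]
  rw [this]; rfl

lemma card_pts (W : Submodule K (V K)) :
    (pts W).ncard * (Nat.card K - 1) + 1 = Nat.card K ^ finrank K W := by
  classical
  rw [← card_nonzero W]
  congr 1
  have hfin : ∀ T : Set (PGPoint K 3), T.Finite := fun T => Set.toFinite T
  have hfin' : ∀ T : Set (V K), T.Finite := fun T => Set.toFinite T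
  rw [Set.ncard_eq_toFinset_card _ (hfin' _), Finset.card_eq_sum_card_fiberwise
    (f := fun v : V K => span K {v}) (t := ((hfin (pts W)).toFinset).image (fun P : PGPoint K 3 => P.sp))]
  · rw [Finset.sum_image (fun P _ Q _ h => sp_inj h),
      Set.ncard_eq_toFinset_card _ (hfin _), ← smul_eq_mul, ← Finset.sum_const]
    apply Finset.sum_congr rfl
    intro P hP
    have hP' : P.sp ≤ W := by simpa [mem_pts] using hP
    have h1 := card_nonzero P.sp
    rw [sp_finrank P, pow_one, Set.ncard_eq_toFinset_card _ (hfin' _)] at h1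
    rw [← h1, Nat.add_sub_cancel]
    congr 1
    ext v
    simp only [Finset.mem_filter, Set.Finite.mem_toFinset, Set.mem_setOf_eq]
    constructor
    · rintro ⟨hv, hv0⟩
      refine ⟨⟨hP' hv, hv0⟩, ?_⟩
      exact congrArg PGPoint.sp (eq_of_le_pt (P := pt v hv0) (Q := P)
        (by simpa [sp_pt] using hv))
    · rintro ⟨⟨hv, hv0⟩, h⟩
      exact ⟨h ▸ mem_span_singleton_self v, hv0⟩
  · intro v hv
    simp only [Set.Finite.coe_toFinset, Set.mem_setOf_eq] at hv
    simp only [Finset.coe_image, Set.Finite.coe_toFinset, Set.mem_image]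
    exact ⟨pt v hv.2, by simpa [mem_pts, sp_pt] using hv.1, rfl⟩

lemma one_lt_q : 1 < Nat.card K := Finite.one_lt_card

lemma card_pts_line (W : Submodule K (V K)) (hW : finrank K W = 2) :
    (pts W).ncard = Nat.card K + 1 := by
  have h := card_pts W
  rw [hW] at h
  have hq := one_lt_q (K := K)
  obtain ⟨r, hr⟩ : ∃ r, Nat.card K = r + 1 := ⟨Nat.card K - 1, by omega⟩
  rw [hr, Nat.add_sub_cancel] at h
  rw [hr]
  have hr0 : 0 < r := by omega
  apply Nat.eq_of_mul_eq_mul_right hr0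
  nlinarith

lemma card_pts_point (W : Submodule K (V K)) (hW : finrank K W ≤ 1) :
    (pts W).ncard ≤ 1 := by
  have h := card_pts W
  have hq := one_lt_q (K := K)
  have h2 : Nat.card K ^ finrank K W ≤ Nat.card K ^ 1 := Nat.pow_le_pow_right (by omega) hW
  rw [pow_one] at h2
  by_contra hc
  have : 2 * (Nat.card K - 1) ≤ (pts W).ncard * (Nat.card K - 1) :=
    Nat.mul_le_mul_right _ (by omega)
  omega

lemma card_Pen (A B : Submodule K (V K)) (hAB : A ≤ B) (h : finrank K B = finrank K A + 2) :
    (Pen A B).card = Nat.card K + 1 := by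
  have hp := partition' Set.univ A B hAB
  have hcnt : ∀ W : Submodule K (V K), cnt Set.univ W * (Nat.card K - 1) + 1 =
      Nat.card K ^ finrank K W := by
    intro W
    unfold cnt
    rw [Set.univ_inter]; exact card_pts W
  have hq := one_lt_q (K := K)
  obtain ⟨r, hr⟩ : ∃ r, Nat.card K = r + 1 := ⟨Nat.card K - 1, by omega⟩
  have hM : ∀ M ∈ Pen A B, cnt Set.univ M = cnt Set.univ A + Nat.card K ^ finrank K A := by
    intro M hM
    have h1 := hcnt M
    have h2 := hcnt A
    rw [(mem_Pen.1 hM).2.2, pow_succ, ← h2] at h1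
    rw [← h2]
    rw [hr, Nat.add_sub_cancel] at h1 ⊢
    have hr0 : 0 < r := by omega
    apply Nat.eq_of_mul_eq_mul_right hr0
    nlinarith
  rw [Finset.sum_congr rfl hM, Finset.sum_const, smul_eq_mul] at hp
  have h1 := hcnt A
  have h2 := hcnt B
  have hpos : 0 < Nat.card K ^ finrank K A := by positivity
  rw [h, pow_add] at h2
  rw [hr, Nat.add_sub_cancel] at h1 h2
  rw [hr] at hp hpos ⊢
  generalize (r + 1) ^ finrank K A = Z at *
  generalize (Pen A B).card = n at *
  generalize cnt Set.univ A = a at *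
  generalize cnt Set.univ B = b at *
  have hr0 : 0 < r := by omega
  have h3 : b = a + n * Z := by nlinarith
  subst h3
  apply Nat.eq_of_mul_eq_mul_right hpos
  apply Nat.eq_of_mul_eq_mul_right hr0
  nlinarith

/-- the basic counting identity -/
lemma pencil (S : Set (PGPoint K 3)) (A B : Submodule K (V K)) (hAB : A ≤ B)
    (h : finrank K B = finrank K A + 2) :
    cnt S B + Nat.card K * cnt S A = ∑ M ∈ Pen A B, cnt S M := by
  have h1 := partition' S A B hAB
  rw [card_Pen A B hAB h] at h1
  have : (Nat.card K + 1) * cnt S A = Nat.card K * cnt S A + cnt S A := by ring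
  omega

lemma cnt_pt_mem (S : Set (PGPoint K 3)) (P : PGPoint K 3) (h : P ∈ S) : cnt S P.sp = 1 := by
  unfold cnt
  rw [Set.ncard_eq_one]
  refine ⟨P, ?_⟩
  ext Q
  simp only [Set.mem_inter_iff, mem_pts, Set.mem_singleton_iff]
  exact ⟨fun hQ => eq_of_le_pt hQ.2, fun hQ => by subst hQ; exact ⟨h, le_rfl⟩⟩

lemma cnt_pt_notMem (S : Set (PGPoint K 3)) (P : PGPoint K 3) (h : P ∉ S) : cnt S P.sp = 0 := by
  unfold cnt
  rw [Set.ncard_eq_zero (Set.toFinite _)]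
  ext Q
  simp only [Set.mem_inter_iff, mem_pts, Set.mem_empty_iff_false, iff_false]
  rintro ⟨h1, h2⟩
  exact h (eq_of_le_pt h2 ▸ h1)

lemma cnt_pos (S : Set (PGPoint K 3)) (W : Submodule K (V K)) :
    0 < cnt S W ↔ ∃ P ∈ S, P.sp ≤ W := by
  unfold cnt
  rw [Set.ncard_pos (Set.toFinite _)]
  rfl

end EvenGeo


set_option linter.unusedSectionVars false
set_option linter.deprecated false

namespace EvenGeo
open Module

variable {K : Type*} [Field K] [Finite K]

lemma even_line {S : Set (PGPoint K 3)} (hE : IsEvenType S) (W : Submodule K (V K))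
    (hW : finrank K W = 2) : Even (cnt S W) := hE (pts W) ⟨W, hW, rfl⟩

lemma line_ge_two {S : Set (PGPoint K 3)} (hE : IsEvenType S) (W : Submodule K (V K))
    (hW : finrank K W = 2) (P : PGPoint K 3) (hP : P ∈ S) (hPW : P.sp ≤ W) : 2 ≤ cnt S W := by
  have h1 := even_line hE W hW
  have h2 := (cnt_pos S W).2 ⟨P, hP, hPW⟩
  obtain ⟨r, hr⟩ := h1
  omega

lemma even_plane {S : Set (PGPoint K 3)} (hE : IsEvenType S) (hq : Even (Nat.card K))
    (W : Submodule K (V K)) (hW : finrank K W = 3) : Even (cnt S W) := by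
  rcases Nat.eq_zero_or_pos (cnt S W) with h | h
  · rw [h]; exact Even.zero
  · obtain ⟨P, hP, hPW⟩ := (cnt_pos S W).1 h
    have h1 := pencil S P.sp W hPW (by rw [hW, sp_finrank])
    have h2 : Even (∑ M ∈ Pen P.sp W, cnt S M) := by
      apply Finset.even_sum
      intro M hM
      exact even_line hE M (by rw [(mem_Pen.1 hM).2.2, sp_finrank])
    rw [← h1, cnt_pt_mem S P hP, mul_one] at h2
    exact (Nat.even_add.1 h2).2 hq

/-- sum over a pencil with one or two distinguished members -/
lemma sum_ge_one {α : Type*} (s : Finset α) (f : α → ℕ) (c : ℕ) (hf : ∀ x ∈ s, c ≤ f x) (a : α)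
    (ha : a ∈ s) : f a + c * (s.card - 1) ≤ ∑ x ∈ s, f x := by
  classical
  rw [← Finset.add_sum_erase s f ha]
  have := Finset.card_nsmul_le_sum (s.erase a) f c (fun x hx => hf x (Finset.mem_of_mem_erase hx))
  rw [Finset.card_erase_of_mem ha, smul_eq_mul, mul_comm] at this
  exact Nat.add_le_add_left this _

lemma sum_ge_two {α : Type*} (s : Finset α) (f : α → ℕ) (c : ℕ) (hf : ∀ x ∈ s, c ≤ f x) (a b : α)
    (ha : a ∈ s) (hb : b ∈ s) (hab : a ≠ b) :
    f a + f b + c * (s.card - 2) ≤ ∑ x ∈ s, f x := by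
  classical
  rw [← Finset.add_sum_erase s f ha]
  have hb' : b ∈ s.erase a := Finset.mem_erase.2 ⟨hab.symm, hb⟩
  have := sum_ge_one (s.erase a) f c (fun x hx => hf x (Finset.mem_of_mem_erase hx)) b hb'
  rw [Finset.card_erase_of_mem ha, Nat.sub_sub] at this
  rw [add_assoc]
  exact Nat.add_le_add_left this _

lemma pen_line {P : PGPoint K 3} {B M : Submodule K (V K)} (hM : M ∈ Pen P.sp B) :
    finrank K M = 2 := by rw [(mem_Pen.1 hM).2.2, sp_finrank]

lemma low_bound {S : Set (PGPoint K 3)} (hE : IsEvenType S) (L W : Submodule K (V K))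
    (hL : finrank K L = 2) (hW : finrank K W = 3) (hLW : L ≤ W) (hpos : 0 < cnt S L) :
    Nat.card K + cnt S L ≤ cnt S W := by
  obtain ⟨P, hP, hPL⟩ := (cnt_pos S L).1 hpos
  have hr : finrank K W = finrank K P.sp + 2 := by rw [hW, sp_finrank]
  have h1 := pencil S P.sp W (hPL.trans hLW) hr
  have h2 := sum_ge_one (Pen P.sp W) (cnt S) 2
    (fun M hM => line_ge_two hE M (pen_line hM) P hP (mem_Pen.1 hM).1) L
    (mem_Pen.2 ⟨hPL, hLW, by rw [hL, sp_finrank]⟩)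
  rw [card_Pen _ _ (hPL.trans hLW) hr, ← h1, cnt_pt_mem S P hP] at h2
  omega

lemma tight_two {S : Set (PGPoint K 3)} (hE : IsEvenType S) (L W : Submodule K (V K))
    (hL : finrank K L = 2) (hW : finrank K W = 3) (hLW : L ≤ W)
    (ht : cnt S W = Nat.card K + cnt S L) (P : PGPoint K 3) (hP : P ∈ S) (hPL : P.sp ≤ L)
    (M : Submodule K (V K)) (hM : finrank K M = 2) (hMW : M ≤ W) (hPM : P.sp ≤ M) (hML : M ≠ L) :
    cnt S M = 2 := by
  have hr : finrank K W = finrank K P.sp + 2 := by rw [hW, sp_finrank]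
  have h1 := pencil S P.sp W (hPL.trans hLW) hr
  have h2 := sum_ge_two (Pen P.sp W) (cnt S) 2
    (fun M hM => line_ge_two hE M (pen_line hM) P hP (mem_Pen.1 hM).1) L M
    (mem_Pen.2 ⟨hPL, hLW, by rw [hL, sp_finrank]⟩)
    (mem_Pen.2 ⟨hPM, hMW, by rw [hM, sp_finrank]⟩) hML.symm
  rw [card_Pen _ _ (hPL.trans hLW) hr, ← h1, cnt_pt_mem S P hP] at h2
  have h3 := line_ge_two hE M hM P hP hPM
  have := one_lt_q (K := K)
  omega

lemma finrank_top4 : finrank K (⊤ : Submodule K (V K)) = 4 := by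
  rw [finrank_top]; simp [V]

lemma cnt_top (S : Set (PGPoint K 3)) : cnt S (⊤ : Submodule K (V K)) = S.ncard := by
  unfold cnt
  congr 1
  ext P
  simp [mem_pts]

lemma excess {S : Set (PGPoint K 3)} (hE : IsEvenType S)
    (hcard : S.ncard = Nat.card K * (Nat.card K + 2)) (L : Submodule K (V K))
    (hL : finrank K L = 2) (hpos : 0 < cnt S L) :
    ∑ M ∈ Pen L ⊤, (cnt S M - (Nat.card K + cnt S L)) + cnt S L = Nat.card K := by
  have h4 : finrank K (⊤ : Submodule K (V K)) = finrank K L + 2 := by rw [finrank_top4, hL]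
  have h1 := pencil S L ⊤ le_top h4
  have h2 : ∑ M ∈ Pen L ⊤, cnt S M = ∑ M ∈ Pen L ⊤, (cnt S M - (Nat.card K + cnt S L)) +
      ∑ M ∈ Pen L ⊤, (Nat.card K + cnt S L) := by
    rw [← Finset.sum_add_distrib]
    apply Finset.sum_congr rfl
    intro M hM
    have := low_bound hE L M hL (by rw [(mem_Pen.1 hM).2.2, hL]) (mem_Pen.1 hM).1 hpos
    omega
  rw [Finset.sum_const, card_Pen L ⊤ le_top h4, smul_eq_mul] at h2
  rw [h2, cnt_top, hcard] at h1
  nlinarith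

lemma mem_Pen_top {L M : Submodule K (V K)} (hL : finrank K L = 2) (hM : finrank K M = 3)
    (h : L ≤ M) : M ∈ Pen L ⊤ := mem_Pen.2 ⟨h, le_top, by rw [hL, hM]⟩

lemma plane_le {S : Set (PGPoint K 3)} (hE : IsEvenType S)
    (hcard : S.ncard = Nat.card K * (Nat.card K + 2)) (L : Submodule K (V K))
    (hL : finrank K L = 2) (hpos : 0 < cnt S L) (M : Submodule K (V K)) (hM : finrank K M = 3)
    (hLM : L ≤ M) : cnt S M ≤ 2 * Nat.card K := by
  have h1 := excess hE hcard L hL hpos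
  have h2 := Finset.single_le_sum (f := fun M => (cnt S M - (Nat.card K + cnt S L)))
    (fun _ _ => Nat.zero_le _) (mem_Pen_top hL hM hLM)
  omega

lemma exists_tight {S : Set (PGPoint K 3)} (hE : IsEvenType S)
    (hcard : S.ncard = Nat.card K * (Nat.card K + 2)) (L : Submodule K (V K))
    (hL : finrank K L = 2) (hpos : 0 < cnt S L) : ∃ M : Submodule K (V K), finrank K M = 3 ∧
    L ≤ M ∧ cnt S M = Nat.card K + cnt S L := by
  by_contra hc
  push Not at hc
  have h4 : finrank K (⊤ : Submodule K (V K)) = finrank K L + 2 := by rw [finrank_top4, hL]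
  have h1 := excess hE hcard L hL hpos
  have h2 := Finset.card_nsmul_le_sum (Pen L ⊤) (fun M => (cnt S M - (Nat.card K + cnt S L))) 1 (by
    intro M hM
    have hM3 : finrank K M = 3 := by rw [(mem_Pen.1 hM).2.2, hL]
    have h3 := low_bound hE L M hL hM3 (mem_Pen.1 hM).1 hpos
    have h5 := hc M hM3 (mem_Pen.1 hM).1
    omega)
  rw [card_Pen L ⊤ le_top h4, smul_eq_mul] at h2
  omega

lemma line_le {S : Set (PGPoint K 3)} (hE : IsEvenType S)
    (hcard : S.ncard = Nat.card K * (Nat.card K + 2)) (L : Submodule K (V K))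
    (hL : finrank K L = 2) : cnt S L ≤ Nat.card K := by
  rcases Nat.eq_zero_or_pos (cnt S L) with h | h
  · omega
  · have := excess hE hcard L hL h
    omega

end EvenGeo


set_option linter.unusedSectionVars false
set_option linter.deprecated false

namespace EvenGeo
open Module

variable {K : Type*} [Field K] [Finite K]

lemma exists_pt_le (W : Submodule K (V K)) (h : 0 < finrank K W) : ∃ P : PGPoint K 3, P.sp ≤ W := by
  obtain ⟨v, hv, hv0⟩ := W.exists_mem_ne_zero_of_ne_bot (by
    rintro rfl; rw [finrank_bot] at h; exact lt_irrefl _ h)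
  exact ⟨pt v hv0, by simpa [sp_pt] using hv⟩

lemma meet {A B C : Submodule K (V K)} (hA : A ≤ C) (hB : B ≤ C)
    (h : finrank K C < finrank K A + finrank K B) :
    ∃ P : PGPoint K 3, P.sp ≤ A ∧ P.sp ≤ B := by
  have h1 := Submodule.finrank_sup_add_finrank_inf_eq A B
  have h2 := Submodule.finrank_mono (sup_le hA hB)
  obtain ⟨P, hP⟩ := exists_pt_le (A ⊓ B) (by omega)
  exact ⟨P, hP.trans inf_le_left, hP.trans inf_le_right⟩

lemma line_eq {P Q : PGPoint K 3} (hPQ : P ≠ Q) {N : Submodule K (V K)} (hN : finrank K N = 2)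
    (hP : P.sp ≤ N) (hQ : Q.sp ≤ N) : P.sp ⊔ Q.sp = N := by
  apply Submodule.eq_of_le_of_finrank_eq (sup_le hP hQ)
  rw [finrank_sup_pt P.sp Q (fun h => hPQ (eq_of_le_pt h).symm), sp_finrank, hN]

lemma finrank_line {P Q : PGPoint K 3} (hPQ : P ≠ Q) : finrank K (P.sp ⊔ Q.sp : Submodule K (V K)) = 2 := by
  rw [finrank_sup_pt P.sp Q (fun h => hPQ (eq_of_le_pt h).symm), sp_finrank]

lemma pt_unique {L N : Submodule K (V K)} (hL : finrank K L = 2) (hN : finrank K N = 2)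
    (hLN : L ≠ N) {P Q : PGPoint K 3} (h1 : P.sp ≤ L) (h2 : P.sp ≤ N) (h3 : Q.sp ≤ L)
    (h4 : Q.sp ≤ N) : P = Q := by
  by_contra hc
  exact hLN ((line_eq hc hL h1 h3).symm.trans (line_eq hc hN h2 h4))

lemma card_off {S : Set (PGPoint K 3)} {N : Submodule K (V K)} (hN : finrank K N = 2) :
    cnt S N + (pts N \ S).ncard = Nat.card K + 1 := by
  have h := Set.ncard_inter_add_ncard_sdiff_eq_ncard (pts N) S (Set.toFinite _)
  rw [card_pts_line N hN, Set.inter_comm] at h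
  exact h

lemma full_line {S : Set (PGPoint K 3)} {N : Submodule K (V K)} (hN : finrank K N = 2)
    (hc : cnt S N = Nat.card K) {Q X : PGPoint K 3} (hQ : Q ∉ S) (hQN : Q.sp ≤ N)
    (hXN : X.sp ≤ N) (hXQ : X ≠ Q) : X ∈ S := by
  have h := card_off (S := S) hN
  have h1 : (pts N \ S).ncard = 1 := by omega
  obtain ⟨Y, hY⟩ := Set.ncard_eq_one.1 h1
  by_contra hX
  have a1 : X ∈ pts N \ S := ⟨hXN, hX⟩
  have a2 : Q ∈ pts N \ S := ⟨hQN, hQ⟩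
  rw [hY] at a1 a2
  exact hXQ (a1.trans a2.symm)

lemma hyper_line {S : Set (PGPoint K 3)} (hE : IsEvenType S)
    (hcard : S.ncard = Nat.card K * (Nat.card K + 2)) (L : Submodule K (V K))
    (hL : finrank K L = 2) (hm : cnt S L = Nat.card K) (Q : PGPoint K 3) (hQ : Q ∉ S)
    (hQL : Q.sp ≤ L) (R : PGPoint K 3) (hR : R ∈ S) : cnt S (Q.sp ⊔ R.sp) = Nat.card K := by
  have hq := one_lt_q (K := K)
  have hQR : Q ≠ R := by rintro rfl; exact hQ hR
  by_cases hRL : R.sp ≤ L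
  · rw [line_eq hQR hL hQL hRL, hm]
  have hpos : 0 < cnt S L := by omega
  have hW : finrank K (L ⊔ R.sp : Submodule K (V K)) = 3 := by rw [finrank_sup_pt L R hRL, hL]
  have h1 := low_bound hE L (L ⊔ R.sp) hL hW le_sup_left hpos
  have h2 := plane_le hE hcard L hL hpos (L ⊔ R.sp) hW le_sup_left
  have hr : finrank K (L ⊔ R.sp : Submodule K (V K)) = finrank K R.sp + 2 := by rw [hW, sp_finrank]
  have h3 := pencil S R.sp (L ⊔ R.sp) le_sup_right hr
  have hN : Q.sp ⊔ R.sp ∈ Pen R.sp (L ⊔ R.sp) := mem_Pen.2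
    ⟨le_sup_right, sup_le_sup_right hQL _, by rw [finrank_line hQR, sp_finrank]⟩
  classical
  rw [← Finset.add_sum_erase _ _ hN] at h3
  have h4 : ∑ M ∈ (Pen R.sp (L ⊔ R.sp)).erase (Q.sp ⊔ R.sp), cnt S M =
      ∑ M ∈ (Pen R.sp (L ⊔ R.sp)).erase (Q.sp ⊔ R.sp), 2 := by
    apply Finset.sum_congr rfl
    intro M hM
    obtain ⟨hM1, hM2⟩ := Finset.mem_erase.1 hM
    obtain ⟨hM3, hM4, hM5⟩ := mem_Pen.1 hM2
    have hM6 := pen_line hM2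
    obtain ⟨X, hXL, hXM⟩ := meet (le_sup_left : L ≤ L ⊔ R.sp) hM4 (by rw [hW, hL, hM6]; norm_num)
    have hXQ : X ≠ Q := by
      rintro rfl
      exact hM1 (line_eq hQR hM6 hXM hM3).symm
    exact tight_two hE L (L ⊔ R.sp) hL hW le_sup_left (by omega) X
      (full_line hL hm hQ hQL hXL hXQ) hXL M hM6 hM4 hXM (by rintro rfl; exact hRL hM3)
  rw [h4, Finset.sum_const, Finset.card_erase_of_mem hN, card_Pen _ _ le_sup_right hr,
    cnt_pt_mem S R hR, smul_eq_mul] at h3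
  omega

theorem hyper {S : Set (PGPoint K 3)} (hE : IsEvenType S)
    (hcard : S.ncard = Nat.card K * (Nat.card K + 2)) (L : Submodule K (V K))
    (hL : finrank K L = 2) (hm : cnt S L = Nat.card K) : IsHypercylinder S := by
  have hq := one_lt_q (K := K)
  obtain ⟨Q, hQL, hQ⟩ : ∃ Q : PGPoint K 3, Q.sp ≤ L ∧ Q ∉ S := by
    have h := card_off (S := S) hL
    obtain ⟨Q, h1, h2⟩ := (Set.ncard_pos (Set.toFinite (pts L \ S))).1 (by omega)
    exact ⟨Q, h1, h2⟩
  have hline := hyper_line hE hcard L hL hm Q hQ hQL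
  obtain ⟨W, hW⟩ := Submodule.exists_isCompl Q.sp
  have hW3 : finrank K W = 3 := by
    have := Submodule.finrank_add_eq_of_isCompl hW
    rw [sp_finrank] at this
    have h4 : finrank K (V K) = 4 := by simp [V]
    have h5 : 1 + finrank K W = 4 := this.trans h4
    omega
  have hQW : ¬ Q.sp ≤ W := by
    intro h
    have h1 : Q.sp ≤ ⊥ := (le_inf le_rfl h).trans hW.disjoint.le_bot
    have h2 := Submodule.finrank_mono h1
    rw [sp_finrank, finrank_bot] at h2
    omega
  -- every line through `Q` meeting `S` meets `W` in a point of `S`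
  have hmeet : ∀ R ∈ S, ∃ P, P ∈ S ∧ P.sp ≤ W ∧ P.sp ≤ Q.sp ⊔ R.sp ∧ P ≠ Q := by
    intro R hR
    have hQR : Q ≠ R := by rintro rfl; exact hQ hR
    obtain ⟨P, hP1, hP2⟩ := meet (le_top : W ≤ ⊤) (le_top : Q.sp ⊔ R.sp ≤ ⊤)
      (by rw [finrank_top4, hW3, finrank_line hQR]; norm_num)
    have hPQ : P ≠ Q := by rintro rfl; exact hQW hP1
    exact ⟨P, full_line (finrank_line hQR) (hline R hR) hQ le_sup_left hP2 hPQ, hP1, hP2, hPQ⟩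
  have hOS : ∀ N : Submodule K (V K), cnt (S ∩ pts W) N ≤ cnt S N := by
    intro N
    apply Set.ncard_le_ncard _ (Set.toFinite _)
    rintro P ⟨⟨h1, h2⟩, h3⟩
    exact ⟨h1, h3⟩
  have hO : (S ∩ pts W).ncard = Nat.card K + 2 := by
    have hQO : Q ∉ S ∩ pts W := fun h => hQ h.1
    have p1 := partition' S Q.sp ⊤ le_top
    have p2 := partition' (S ∩ pts W) Q.sp ⊤ le_top
    rw [cnt_pt_notMem S Q hQ, cnt_top, hcard] at p1
    rw [cnt_pt_notMem _ Q hQO, cnt_top] at p2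
    simp only [mul_zero, add_zero, zero_add] at p1 p2
    have p3 : ∑ M ∈ Pen Q.sp ⊤, cnt S M = Nat.card K * ∑ M ∈ Pen Q.sp ⊤, cnt (S ∩ pts W) M := by
      rw [Finset.mul_sum]
      apply Finset.sum_congr rfl
      intro M hM
      rcases Nat.eq_zero_or_pos (cnt S M) with h | h
      · have := hOS M
        rw [h] at this ⊢
        rw [Nat.le_zero.1 this, mul_zero]
      · obtain ⟨R, hR, hRM⟩ := (cnt_pos S M).1 h
        have hQR : Q ≠ R := by rintro rfl; exact hQ hR
        have hMe := line_eq hQR (pen_line hM) (mem_Pen.1 hM).1 hRM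
        obtain ⟨P, hP1, hP2, hP3, hP4⟩ := hmeet R hR
        have : cnt (S ∩ pts W) M = 1 := by
          unfold cnt
          rw [Set.ncard_eq_one]
          refine ⟨P, ?_⟩
          ext X
          constructor
          · rintro ⟨⟨x1, x2⟩, x3⟩
            by_contra hXP
            have := line_eq hXP (pen_line hM) x3 (hMe ▸ hP3)
            apply hQW
            calc Q.sp ≤ M := (mem_Pen.1 hM).1
              _ = X.sp ⊔ P.sp := this.symm
              _ ≤ W := sup_le x2 hP2
          · rintro rfl
            exact ⟨⟨hP1, hP2⟩, hMe ▸ hP3⟩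
        rw [this, mul_one, ← hMe, hline R hR]
    rw [← p1, ← p2] at p3
    exact (Nat.eq_of_mul_eq_mul_left (by omega) p3).symm
  refine ⟨W, Q.sp, S ∩ pts W, hW3, sp_finrank Q, ?_, ⟨Set.inter_subset_right, hO, ?_⟩, ?_⟩
  · rw [inf_comm]; exact hW.inf_eq_bot
  · rintro N ⟨N, hN, rfl⟩
    by_contra hc
    push Not at hc
    obtain ⟨X, hX, Y, hY, hXY⟩ := (Set.one_lt_ncard (Set.toFinite _)).1 (by omega : 1 < (S ∩ pts W ∩ pts N).ncard)
    have hNW : N ≤ W := by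
      rw [← line_eq hXY hN hX.2 hY.2]
      exact sup_le hX.1.2 hY.1.2
    have h1 := hOS N
    have h2 := low_bound hE N W hN hW3 hNW ((cnt_pos S N).2 ⟨X, hX.1.1, hX.2⟩)
    have h3 : cnt S W = Nat.card K + 2 := hO
    have h4 : 2 < cnt (S ∩ pts W) N := hc
    omega
  · ext X
    constructor
    · intro hX
      obtain ⟨P, hP1, hP2, hP3, hP4⟩ := hmeet X hX
      have hQX : Q ≠ X := by rintro rfl; exact hQ hX
      refine ⟨⟨P, ⟨hP1, hP2⟩, ?_⟩, fun h => hQX (eq_of_le_pt h).symm⟩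
      have := line_eq hP4 (finrank_line hQX) hP3 le_sup_left
      change X.sp ≤ P.sp ⊔ Q.sp
      rw [this]; exact le_sup_right
    · rintro ⟨⟨P, ⟨hP1, hP2⟩, hP3⟩, hX⟩
      have hQP : Q ≠ P := by rintro rfl; exact hQ hP1
      have hP3' : X.sp ≤ Q.sp ⊔ P.sp := by rw [sup_comm]; exact hP3
      exact full_line (finrank_line hQP) (hline P hP1) hQ le_sup_left hP3'
        (fun h => hX (by rw [h]; exact le_rfl))

end EvenGeo


set_option linter.unusedSectionVars false
set_option linter.deprecated false

namespace EvenGeo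
open Module

variable {K : Type*} [Field K] [Finite K]

/-- the vector `v` represents a point of `S` -/
def inS (S : Set (PGPoint K 3)) (v : V K) : Prop := ∃ P ∈ S, P.sp = span K {v}

lemma inS_pt (S : Set (PGPoint K 3)) (v : V K) (hv : v ≠ 0) : inS S v ↔ pt v hv ∈ S := by
  constructor
  · rintro ⟨P, hP, h⟩
    have : P = pt v hv := sp_inj (by rw [h, sp_pt])
    exact this ▸ hP
  · intro h
    exact ⟨_, h, sp_pt v hv⟩

lemma add_ne {v w : V K} (hw : w ∉ span K {v}) (z : K) : w + z • v ∉ span K {v} := by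
  intro h
  apply hw
  have h1 : z • v ∈ span K {v} := smul_mem _ _ (mem_span_singleton_self v)
  have := sub_mem h h1
  rwa [add_sub_cancel_right] at this

lemma ne_zero_of {v w : V K} (hw : w ∉ span K {v}) : w ≠ 0 := by
  rintro rfl; exact hw (zero_mem _)

lemma finrank_pair {v w : V K} (hv : v ≠ 0) (hw : w ∉ span K {v}) :
    finrank K (span K {v, w}) = 2 := by
  have h := finrank_sup_pt (span K {v}) (pt w (ne_zero_of hw)) (by
    rw [sp_pt, span_singleton_le_iff_mem]; exact hw)
  rw [sp_pt, ← span_union, finrank_span_singleton hv] at h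
  exact h

lemma line_count (S : Set (PGPoint K 3)) (v w : V K) (hv : v ≠ 0) (hw : w ∉ span K {v}) :
    cnt S (span K {v, w}) = cnt S (pt v hv).sp + {z : K | inS S (w + z • v)}.ncard := by
  have hAM : (pt v hv).sp ≤ span K {v, w} := by
    rw [sp_pt]; exact span_mono (by simp)
  rw [← cnt_diff S (pt v hv).sp _ hAM, add_comm]
  congr 1
  symm
  have hne : ∀ z : K, w + z • v ≠ 0 := fun z => ne_zero_of (add_ne hw z)
  refine Set.ncard_congr (fun z _ => pt (w + z • v) (hne z)) ?_ ?_ ?_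
  · intro z hz
    refine ⟨⟨(inS_pt S _ (hne z)).1 hz, ?_⟩, ?_⟩
    · rw [mem_pts, sp_pt, span_singleton_le_iff_mem]
      exact add_mem (subset_span (by simp)) (smul_mem _ _ (subset_span (by simp)))
    · rw [mem_pts, sp_pt, sp_pt, span_singleton_le_iff_mem]
      exact add_ne hw z
  · intro z z' _ _ h
    have h1 := congrArg PGPoint.sp h
    rw [sp_pt, sp_pt] at h1
    have h2 : w + z • v ∈ span K {w + z' • v} := h1 ▸ mem_span_singleton_self _
    obtain ⟨c, hc⟩ := mem_span_singleton.1 h2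
    have h3 : (1 - c) • w = (c * z' - z) • v := by
      rw [sub_smul, sub_smul, one_smul, mul_smul]
      rw [smul_add] at hc
      rw [sub_eq_sub_iff_add_eq_add, ← hc, add_comm]
    have hc1 : 1 - c = 0 := by
      by_contra h0
      apply hw
      rw [mem_span_singleton]
      refine ⟨(1 - c)⁻¹ * (c * z' - z), ?_⟩
      rw [mul_smul, ← h3, smul_smul, inv_mul_cancel₀ h0, one_smul]
    rw [hc1, zero_smul] at h3
    have h4 := (smul_eq_zero.1 h3.symm).resolve_right hv
    have h5 : c = 1 := (sub_eq_zero.1 hc1).symm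
    rw [h5, one_mul] at h4
    exact (sub_eq_zero.1 h4).symm
  · rintro P ⟨⟨hP1, hP2⟩, hP3⟩
    obtain ⟨u, hu, hPu⟩ := exists_pt P
    rw [mem_pts, hPu, span_singleton_le_iff_mem, mem_span_pair] at hP2
    rw [mem_pts, hPu, sp_pt, span_singleton_le_iff_mem] at hP3
    obtain ⟨α, β, hab⟩ := hP2
    have hβ : β ≠ 0 := by
      rintro rfl
      apply hP3
      rw [← hab, zero_smul, add_zero]
      exact smul_mem _ _ (mem_span_singleton_self v)
    have hue : u = β • (w + (β⁻¹ * α) • v) := by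
      rw [← hab, smul_add, smul_smul, mul_inv_cancel_left₀ hβ, add_comm]
    have hsp : P.sp = span K {w + (β⁻¹ * α) • v} := by
      rw [hPu, hue]
      exact span_singleton_smul_eq (IsUnit.mk0 β hβ) _
    refine ⟨β⁻¹ * α, ⟨P, hP1, hsp⟩, ?_⟩
    exact sp_inj (by rw [sp_pt, hsp])

end EvenGeo


set_option linter.unusedSectionVars false
set_option linter.deprecated false

namespace EvenGeo
open Module

variable {K : Type*} [Field K] [Finite K]

theorem tight_planar [CharP K 2] (h : ℕ) (hq : Nat.card K = 2 ^ h)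
    {S : Set (PGPoint K 3)} (hE : IsEvenType S)
    (hcard : S.ncard = Nat.card K * (Nat.card K + 2)) (L : Submodule K (V K))
    (hL : finrank K L = 2) (hpos : 0 < cnt S L) (hm : cnt S L < Nat.card K) :
    ∃ e, e ∣ h ∧ 1 ≤ e ∧ 2 ^ e < Nat.card K ∧
      Nat.card K / 2 ^ e + 1 ≤ Nat.card K + 1 - cnt S L ∧
      (Nat.card K + 1 - cnt S L) * (2 ^ e - 1) ≤ Nat.card K - 1 := by
  classical
  obtain ⟨W, hW, hLW, ht⟩ := exists_tight hE hcard L hL hpos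
  obtain ⟨P, hP, hPL⟩ := (cnt_pos S L).1 hpos
  obtain ⟨b, hb, hPb⟩ := exists_pt P
  have hPpt : P = pt b hb := sp_inj (by rw [hPb, sp_pt])
  have hbL : b ∈ L := by rw [hPb, span_singleton_le_iff_mem] at hPL; exact hPL
  obtain ⟨a, haL, hab⟩ : ∃ a ∈ L, a ∉ span K {b} := by
    by_contra hc
    push Not at hc
    have h1 := Submodule.finrank_mono (show L ≤ span K {b} from hc)
    rw [finrank_span_singleton hb, hL] at h1
    omega
  obtain ⟨c, hcW, hcL⟩ : ∃ c ∈ W, c ∉ L := by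
    by_contra hc
    push Not at hc
    have h1 := Submodule.finrank_mono (show W ≤ L from hc)
    rw [hW, hL] at h1
    omega
  have hLe : span K {b, a} = L := by
    apply Submodule.eq_of_le_of_finrank_eq
    · rw [span_le]
      rintro x (rfl | rfl)
      · exact hbL
      · exact haL
    · rw [finrank_pair hb hab, hL]
  have hcad : ∀ u ∈ L, c + u ∉ L := by
    intro u hu hc
    have := sub_mem hc hu
    rw [add_sub_cancel_right] at this
    exact hcL this
  have hnot : ∀ u ∈ L, ∀ v ∈ L, c + u ∉ span K {v} := by
    intro u hu v hv hc
    exact hcad u hu ((span_singleton_le_iff_mem v L).2 hv hc)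
  have hspW : ∀ u ∈ L, ∀ v ∈ L, span K {v, c + u} ≤ W := by
    intro u hu v hv
    rw [span_le]
    rintro x (rfl | rfl)
    · exact hLW hv
    · exact add_mem hcW (hLW hu)
  have hspL : ∀ u ∈ L, ∀ v, span K {v, c + u} ≠ L := by
    intro u hu v hc
    apply hcad u hu
    rw [← hc]
    exact subset_span (by simp)
  have htwo : ∀ u ∈ L, ∀ v ∈ L, ∀ hv0 : v ≠ 0, pt v hv0 ∈ S → cnt S (span K {v, c + u}) = 2 := by
    intro u hu v hv hv0 hS
    exact tight_two hE L W hL hW hLW ht (pt v hv0) hS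
      (by rw [sp_pt, span_singleton_le_iff_mem]; exact hv) _
      (finrank_pair hv0 (hnot u hu v hv)) (hspW u hu v hv)
      (by rw [sp_pt]; exact span_mono (by simp)) (hspL u hu v)
  -- the function
  have hf : ∀ x : K, ∃ z : K, {z : K | inS S (c + x • a + z • b)} = {z} := by
    intro x
    have hxa : x • a ∈ L := smul_mem _ _ haL
    have h1 := line_count S b (c + x • a) hb (hnot _ hxa b hbL)
    rw [htwo _ hxa b hbL hb (hPpt ▸ hP), cnt_pt_mem S _ (hPpt ▸ hP)] at h1
    exact Set.ncard_eq_one.1 (by omega)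
  choose f hf using hf
  have hf' : ∀ x z : K, inS S (c + x • a + z • b) ↔ z = f x := by
    intro x z
    have := hf x
    rw [Set.ext_iff] at this
    exact this z
  have hayL : ∀ y : K, a + y • b ∈ L := fun y => add_mem haL (smul_mem _ _ hbL)
  have hay0 : ∀ y : K, a + y • b ≠ 0 := fun y => ne_zero_of (add_ne hab y)
  have : Fintype K := Fintype.ofFinite K
  have hqF : Fintype.card K = Nat.card K := (Nat.card_eq_fintype_card).symm
  have hset : ∀ y v : K, cnt S (span K {a + y • b, c + v • b}) =
      cnt S (pt (a + y • b) (hay0 y)).sp +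
        (Finset.univ.filter (fun x => x * y + f x = v)).card := by
    intro y v
    have hvb : v • b ∈ L := smul_mem _ _ hbL
    rw [line_count S (a + y • b) (c + v • b) (hay0 y) (hnot _ hvb _ (hayL y))]
    congr 1
    rw [← Set.ncard_coe_finset]
    congr 1
    ext t
    simp only [Set.mem_setOf_eq, Finset.coe_filter, Finset.mem_univ, true_and]
    have e1 : c + v • b + t • (a + y • b) = c + t • a + (v + t * y) • b := by
      rw [smul_add, smul_smul, add_smul]; abel
    rw [e1, hf']
    constructor
    · intro h
      rw [← h]
      have := CharTwo.add_self_eq_zero (t * y)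
      linear_combination this
    · intro h
      rw [← h]
      have := CharTwo.add_self_eq_zero (t * y)
      linear_combination this
  let D : Finset K := Finset.univ.filter (fun y => ¬ inS S (a + y • b))
  have hDm : ∀ y, y ∈ D ↔ pt (a + y • b) (hay0 y) ∉ S := by
    intro y
    simp only [D, Finset.mem_filter, Finset.mem_univ, true_and]
    rw [inS_pt S _ (hay0 y)]
  have hDcard : D.card = Nat.card K + 1 - cnt S L := by
    have h1 := line_count S b a hb hab
    rw [hLe, cnt_pt_mem S _ (hPpt ▸ hP)] at h1
    have h2 : {z : K | inS S (a + z • b)}.ncard =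
        (Finset.univ.filter (fun y : K => inS S (a + y • b))).card := by
      rw [← Set.ncard_coe_finset]
      congr 1
      ext t
      simp
    have h3 := Finset.card_filter_add_card_filter_not (s := (Finset.univ : Finset K))
      (fun y : K => inS S (a + y • b))
    rw [Finset.card_univ, hqF] at h3
    change (Finset.univ.filter (fun y : K => ¬ inS S (a + y • b))).card = _
    omega
  have key := EvenAlg.planar h (by rw [hqF, hq]) f D ?_ ?_ ?_
  · rw [hDcard, hqF] at key
    exact key
  · intro y hy
    rw [hDm, not_not] at hy
    have hone : ∀ v, (Finset.univ.filter (fun x => x * y + f x = v)).card = 1 := by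
      intro v
      have h1 := hset y v
      rw [htwo _ (smul_mem _ _ hbL) _ (hayL y) (hay0 y) hy, cnt_pt_mem S _ hy] at h1
      omega
    have hsurj : Function.Surjective (fun x => x * y + f x) := by
      intro v
      obtain ⟨x, hx⟩ := Finset.card_eq_one.1 (hone v)
      have : x ∈ Finset.univ.filter (fun x => x * y + f x = v) := by rw [hx]; simp
      exact ⟨x, by simpa using this⟩
    exact Finite.surjective_iff_bijective.1 hsurj
  · intro y hy v
    rw [hDm] at hy
    have h1 := hset y v
    rw [cnt_pt_notMem S _ hy, zero_add] at h1
    rw [← h1]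
    exact even_line hE _ (finrank_pair (hay0 y) (hnot _ (smul_mem _ _ hbL) _ (hayL y)))
  · omega

end EvenGeo


set_option linter.unusedSectionVars false
set_option linter.deprecated false

namespace EvenGeo
open Module

variable {K : Type*} [Field K] [Finite K]

lemma cross {S : Set (PGPoint K 3)} (hE : IsEvenType S)
    (hcard : S.ncard = Nat.card K * (Nat.card K + 2)) (L₁ L₂ : Submodule K (V K))
    (hL₁ : finrank K L₁ = 2) (hL₂ : finrank K L₂ = 2) (hne : L₁ ≠ L₂) (Q : PGPoint K 3)
    (hQ₁ : Q.sp ≤ L₁) (hQ₂ : Q.sp ≤ L₂)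
    (hm₁ : cnt S L₁ < Nat.card K)
    (h₁ : 2 * Nat.card K + 4 ≤ 3 * cnt S L₁) (h₂ : 2 * Nat.card K + 4 ≤ 3 * cnt S L₂) : False := by
  classical
  have hq := one_lt_q (K := K)
  have hW : finrank K (L₁ ⊔ L₂ : Submodule K (V K)) = 3 := by
    have h1 := Submodule.finrank_sup_add_finrank_inf_eq L₁ L₂
    have h2 : L₁ ⊓ L₂ = Q.sp := by
      apply le_antisymm _ (le_inf hQ₁ hQ₂)
      intro v hv
      by_cases hv0 : v = 0
      · rw [hv0]; exact zero_mem _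
      · have hv1 : (pt v hv0).sp ≤ L₁ := by
          rw [sp_pt, span_singleton_le_iff_mem]; exact hv.1
        have hv2 : (pt v hv0).sp ≤ L₂ := by
          rw [sp_pt, span_singleton_le_iff_mem]; exact hv.2
        have := pt_unique hL₁ hL₂ hne hv1 hv2 hQ₁ hQ₂
        rw [← this, sp_pt]
        exact mem_span_singleton_self v
    rw [h2, sp_finrank, hL₁, hL₂] at h1
    omega
  have hple := plane_le hE hcard L₁ hL₁ (by omega) (L₁ ⊔ L₂) hW le_sup_left
  by_cases hQS : Q ∈ S
  · have hr : finrank K (L₁ ⊔ L₂ : Submodule K (V K)) = finrank K Q.sp + 2 := by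
      rw [hW, sp_finrank]
    have h1 := pencil S Q.sp (L₁ ⊔ L₂) (hQ₁.trans le_sup_left) hr
    have h2 := sum_ge_two (Pen Q.sp (L₁ ⊔ L₂)) (cnt S) 2
      (fun M hM => line_ge_two hE M (pen_line hM) Q hQS (mem_Pen.1 hM).1) L₁ L₂
      (mem_Pen.2 ⟨hQ₁, le_sup_left, by rw [hL₁, sp_finrank]⟩)
      (mem_Pen.2 ⟨hQ₂, le_sup_right, by rw [hL₂, sp_finrank]⟩) hne
    rw [card_Pen _ _ (hQ₁.trans le_sup_left) hr, ← h1, cnt_pt_mem S Q hQS] at h2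
    omega
  · obtain ⟨X, ⟨hX1, hXS⟩, hXQ⟩ : ∃ X ∈ pts L₁ \ S, X ≠ Q := by
      have h := card_off (S := S) hL₁
      exact Set.exists_ne_of_one_lt_ncard (by omega) Q
    have hX1' : X.sp ≤ L₁ := hX1
    have hX2 : ¬ X.sp ≤ L₂ := fun h => hXQ (pt_unique hL₁ hL₂ hne hX1 h hQ₁ hQ₂)
    have hr : finrank K (L₁ ⊔ L₂ : Submodule K (V K)) = finrank K X.sp + 2 := by
      rw [hW, sp_finrank]
    have hXW : X.sp ≤ L₁ ⊔ L₂ := hX1'.trans le_sup_left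
    have p1 := pencil S X.sp _ hXW hr
    have p2 := pencil (S ∩ pts L₂) X.sp _ hXW hr
    rw [cnt_pt_notMem S X hXS, mul_zero, add_zero] at p1
    rw [cnt_pt_notMem _ X (fun h => hXS h.1), mul_zero, add_zero] at p2
    have hT : cnt (S ∩ pts L₂) (L₁ ⊔ L₂) = cnt S L₂ := by
      unfold cnt
      congr 1
      apply Set.inter_eq_left.2
      rintro P ⟨_, hP⟩
      exact (mem_pts.1 hP).trans le_sup_right
    have hL1 : L₁ ∈ Pen X.sp (L₁ ⊔ L₂) := mem_Pen.2 ⟨hX1, le_sup_left, by rw [hL₁, sp_finrank]⟩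
    have hT1 : cnt (S ∩ pts L₂) L₁ = 0 := by
      rw [← Nat.le_zero, ← not_lt, cnt_pos]
      rintro ⟨P, ⟨hP1, hP2⟩, hP3⟩
      exact hQS (pt_unique hL₁ hL₂ hne hP3 hP2 hQ₁ hQ₂ ▸ hP1)
    rw [← Finset.add_sum_erase _ _ hL1] at p1 p2
    rw [hT1, zero_add, hT] at p2
    have h3 : 2 * ∑ M ∈ (Pen X.sp (L₁ ⊔ L₂)).erase L₁, cnt (S ∩ pts L₂) M ≤
        ∑ M ∈ (Pen X.sp (L₁ ⊔ L₂)).erase L₁, cnt S M := by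
      rw [Finset.mul_sum]
      apply Finset.sum_le_sum
      intro M hM
      obtain ⟨hM1, hM2⟩ := Finset.mem_erase.1 hM
      have hM3 := pen_line hM2
      have hML : M ≠ L₂ := by rintro rfl; exact hX2 (mem_Pen.1 hM2).1
      rcases Nat.eq_zero_or_pos (cnt (S ∩ pts L₂) M) with h | h
      · omega
      · obtain ⟨P, ⟨hP1, hP2⟩, hP3⟩ := (cnt_pos _ M).1 h
        have h4 := line_ge_two hE M hM3 P hP1 hP3
        have h5 : cnt (S ∩ pts L₂) M ≤ 1 := by
          unfold cnt
          rw [Set.ncard_le_one (Set.toFinite _)]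
          rintro A ⟨⟨_, hA2⟩, hA3⟩ B ⟨⟨_, hB2⟩, hB3⟩
          exact pt_unique hM3 hL₂ hML hA3 hA2 hB3 hB2
        omega
    rw [← p2, ] at h3
    omega

/-- auxiliary set for the skew case -/
def Aset (S : Set (PGPoint K 3)) (L₁ L₂ : Submodule K (V K)) : Set (PGPoint K 3) :=
  {Z | Z ∈ S ∧ ¬ Z.sp ≤ L₁ ∧ ¬ Z.sp ≤ L₂ ∧ cnt S (L₁ ⊔ Z.sp) = Nat.card K + cnt S L₁ ∧
    ∃ R ∈ S, R.sp ≤ L₂ ∧ R.sp ≤ L₁ ⊔ Z.sp}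

lemma Aset_disj {S : Set (PGPoint K 3)} (hE : IsEvenType S) (L₁ L₂ : Submodule K (V K))
    (hL₁ : finrank K L₁ = 2) (hL₂ : finrank K L₂ = 2)
    (hsk : ∀ X : PGPoint K 3, X.sp ≤ L₁ → ¬ X.sp ≤ L₂) :
    Disjoint (Aset S L₁ L₂) (Aset S L₂ L₁) := by
  rw [Set.disjoint_left]
  rintro Z ⟨hZ, hZ1, hZ2, ht, R, hR, hR2, hRZ⟩ ⟨_, _, _, _, R', hR', hR1', hRZ'⟩
  have hZR : Z ≠ R := by rintro rfl; exact hZ2 hR2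
  have hM : finrank K (L₁ ⊔ Z.sp : Submodule K (V K)) = 3 := by rw [finrank_sup_pt _ _ hZ1, hL₁]
  have hM' : finrank K (L₂ ⊔ Z.sp : Submodule K (V K)) = 3 := by rw [finrank_sup_pt _ _ hZ2, hL₂]
  have hN := finrank_line hZR
  have hNM : Z.sp ⊔ R.sp ≤ L₁ ⊔ Z.sp := sup_le le_sup_right hRZ
  obtain ⟨X, hX1, hXN⟩ := meet (le_sup_left : L₁ ≤ L₁ ⊔ Z.sp) hNM
    (by rw [hM, hL₁, hN]; norm_num)
  have hXM' : X.sp ≤ L₂ ⊔ Z.sp := hXN.trans (sup_le le_sup_right (hR2.trans le_sup_left))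
  have hXR' : X = R' := by
    by_contra hc
    have h1 := line_eq hc hL₁ hX1 hR1'
    have h2 : L₁ ≤ L₂ ⊔ Z.sp := by rw [← h1]; exact sup_le hXM' hRZ'
    obtain ⟨Y, hY1, hY2⟩ := meet h2 (le_sup_left : L₂ ≤ L₂ ⊔ Z.sp)
      (by rw [hM', hL₁, hL₂]; norm_num)
    exact hsk Y hY1 hY2
  subst hXR'
  have h2 := tight_two hE L₁ (L₁ ⊔ Z.sp) hL₁ hM le_sup_left ht X hR' hX1 (Z.sp ⊔ R.sp) hN hNM hXN
    (by intro h; exact hZ1 (h ▸ le_sup_left))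
  have hZX : Z ≠ X := by rintro rfl; exact hZ1 hX1
  have hRX : R ≠ X := by rintro rfl; exact hsk R hX1 hR2
  have h3 : ({Z, R, X} : Set (PGPoint K 3)).ncard ≤ cnt S (Z.sp ⊔ R.sp) := by
    apply Set.ncard_le_ncard _ (Set.toFinite _)
    rintro Y (rfl | rfl | rfl)
    · exact ⟨hZ, mem_pts.2 le_sup_left⟩
    · exact ⟨hR, mem_pts.2 le_sup_right⟩
    · exact ⟨hR', hXN⟩
  rw [h2, Set.ncard_eq_three.2 ⟨Z, R, X, hZR, hZX, hRX, rfl⟩] at h3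
  omega

lemma Aset_card {S : Set (PGPoint K 3)} (hE : IsEvenType S) (hev : Even (Nat.card K))
    (hcard : S.ncard = Nat.card K * (Nat.card K + 2)) (L₁ L₂ : Submodule K (V K))
    (hL₁ : finrank K L₁ = 2) (hL₂ : finrank K L₂ = 2)
    (hsk : ∀ X : PGPoint K 3, X.sp ≤ L₁ → ¬ X.sp ≤ L₂) (hpos : 0 < cnt S L₁) :
    2 * (Nat.card K - 1) * cnt S L₂ ≤
      2 * (Aset S L₁ L₂).ncard + (Nat.card K - 1) * (Nat.card K - cnt S L₁) := by
  have hq := one_lt_q (K := K)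
  have p1 := partition' (Aset S L₁ L₂) L₁ ⊤ le_top
  have p2 := partition' (S ∩ pts L₂) L₁ ⊤ le_top
  have z1 : cnt (Aset S L₁ L₂) L₁ = 0 := by
    rw [← Nat.le_zero, ← not_lt, cnt_pos]
    rintro ⟨P, ⟨_, hP, _⟩, hP3⟩
    exact hP hP3
  have z2 : cnt (S ∩ pts L₂) L₁ = 0 := by
    rw [← Nat.le_zero, ← not_lt, cnt_pos]
    rintro ⟨P, ⟨_, hP⟩, hP3⟩
    exact hsk P hP3 hP
  rw [z1, mul_zero, add_zero, zero_add, cnt_top] at p1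
  rw [z2, mul_zero, add_zero, zero_add, cnt_top] at p2
  have p2' : cnt S L₂ = _ := p2
  have p3 := excess hE hcard L₁ hL₁ hpos
  have p3' : Nat.card K - cnt S L₁ = ∑ M ∈ Pen L₁ ⊤, (cnt S M - (Nat.card K + cnt S L₁)) := by
    omega
  rw [p1, p2', p3', Finset.mul_sum, Finset.mul_sum, Finset.mul_sum, ← Finset.sum_add_distrib]
  apply Finset.sum_le_sum
  intro M hM
  have hM3 : finrank K M = 3 := by rw [(mem_Pen.1 hM).2.2, hL₁]
  have hLM := (mem_Pen.1 hM).1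
  rcases Nat.eq_zero_or_pos (cnt (S ∩ pts L₂) M) with h | h
  · rw [h, mul_zero]; exact Nat.zero_le _
  obtain ⟨R, ⟨hR, hR2⟩, hRM⟩ := (cnt_pos _ M).1 h
  have huniq : ∀ X : PGPoint K 3, X.sp ≤ L₂ → X.sp ≤ M → X = R := by
    intro X hX1 hX2
    by_contra hc
    have h1 := line_eq hc hL₂ hX1 hR2
    have h2 : L₂ ≤ M := by rw [← h1]; exact sup_le hX2 hRM
    obtain ⟨Y, hY1, hY2⟩ := meet hLM h2 (by rw [hM3, hL₁, hL₂]; norm_num)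
    exact hsk Y hY1 hY2
  have hle1 : cnt (S ∩ pts L₂) M ≤ 1 := by
    unfold cnt
    rw [Set.ncard_le_one (Set.toFinite _)]
    rintro A ⟨⟨_, hA2⟩, hA3⟩ B ⟨⟨_, hB2⟩, hB3⟩
    rw [huniq A hA2 hA3, huniq B hB2 hB3]
  have h1 : cnt (S ∩ pts L₂) M = 1 := by omega
  rw [h1, mul_one]
  have hlow := low_bound hE L₁ M hL₁ hM3 hLM hpos
  obtain ⟨x, hx⟩ := even_plane hE hev M hM3
  obtain ⟨y, hy⟩ := even_line hE L₁ hL₁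
  obtain ⟨z, hz⟩ := hev
  rcases Nat.eq_zero_or_pos (cnt S M - (Nat.card K + cnt S L₁)) with h0 | h0
  · have ht : cnt S M = Nat.card K + cnt S L₁ := by omega
    have hsub : S ∩ pts M ⊆ (Aset S L₁ L₂ ∩ pts M) ∪ ((S ∩ pts L₁) ∪ {R}) := by
      rintro Z ⟨hZ, hZM⟩
      by_cases hZ1 : Z.sp ≤ L₁
      · exact Or.inr (Or.inl ⟨hZ, hZ1⟩)
      by_cases hZ2 : Z.sp ≤ L₂
      · exact Or.inr (Or.inr (huniq Z hZ2 hZM))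
      · have hMe := pen_eq hM Z hZ1 hZM
        exact Or.inl ⟨⟨hZ, hZ1, hZ2, by rw [hMe, ht], R, hR, hR2, by rw [hMe]; exact hRM⟩, hZM⟩
    have c1 := Set.ncard_le_ncard hsub (Set.toFinite _)
    have c2 := Set.ncard_union_le (Aset S L₁ L₂ ∩ pts M) ((S ∩ pts L₁) ∪ {R})
    have c3 := Set.ncard_union_le (S ∩ pts L₁) {R}
    rw [Set.ncard_singleton] at c3
    have c4 : cnt S M ≤ cnt (Aset S L₁ L₂) M + (cnt S L₁ + 1) :=
      c1.trans (c2.trans (Nat.add_le_add_left c3 _))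
    rw [h0, mul_zero]
    omega
  · have h2 : 2 ≤ cnt S M - (Nat.card K + cnt S L₁) := by omega
    have := Nat.mul_le_mul_left (Nat.card K - 1) h2
    omega

lemma skew {S : Set (PGPoint K 3)} (hE : IsEvenType S) (hev : Even (Nat.card K))
    (hcard : S.ncard = Nat.card K * (Nat.card K + 2)) (L₁ L₂ : Submodule K (V K))
    (hL₁ : finrank K L₁ = 2) (hL₂ : finrank K L₂ = 2)
    (hsk : ∀ X : PGPoint K 3, X.sp ≤ L₁ → ¬ X.sp ≤ L₂)
    (h₁ : 2 * Nat.card K + 4 ≤ 3 * cnt S L₁) (h₂ : 2 * Nat.card K + 4 ≤ 3 * cnt S L₂) : False := by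
  have hq := one_lt_q (K := K)
  have hd := Aset_disj hE L₁ L₂ hL₁ hL₂ hsk
  have c1 := Aset_card hE hev hcard L₁ L₂ hL₁ hL₂ hsk (by omega)
  have c2 := Aset_card hE hev hcard L₂ L₁ hL₂ hL₁ (fun X h1 h2 => hsk X h2 h1) (by omega)
  have hl1 := line_le hE hcard L₁ hL₁
  have hl2 := line_le hE hcard L₂ hL₂
  have hsub : Aset S L₁ L₂ ∪ Aset S L₂ L₁ ⊆ S \ pts L₁ := by
    rintro Z (hZ | hZ)
    · exact ⟨hZ.1, hZ.2.1⟩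
    · exact ⟨hZ.1, hZ.2.2.1⟩
  have c3 := Set.ncard_le_ncard hsub (Set.toFinite _)
  rw [Set.ncard_union_eq hd (Set.toFinite _) (Set.toFinite _)] at c3
  have c4 := Set.ncard_inter_add_ncard_sdiff_eq_ncard S (pts L₁) (Set.toFinite _)
  rw [hcard] at c4
  have c5 : cnt S L₁ + (S \ pts L₁).ncard = Nat.card K * (Nat.card K + 2) := c4
  obtain ⟨x, hx⟩ := Nat.exists_eq_add_of_le hl1
  obtain ⟨y, hy⟩ := Nat.exists_eq_add_of_le hl2
  obtain ⟨r, hr⟩ := Nat.exists_eq_add_of_lt hq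
  have e1 : Nat.card K - cnt S L₁ = x := by omega
  have e2 : Nat.card K - cnt S L₂ = y := by omega
  have e3 : Nat.card K - 1 = r + 1 := by omega
  rw [e1, e3] at c1
  rw [e2, e3] at c2
  generalize cnt S L₁ = m₁ at *
  generalize cnt S L₂ = m₂ at *
  generalize (Aset S L₁ L₂).ncard = a₁ at *
  generalize (Aset S L₂ L₁).ncard = a₂ at *
  generalize Nat.card K = q at *
  have hq2 : q = r + 2 := by omega
  subst hq2
  have k1 : 2 * (a₁ + a₂) + (r + 1) * (x + y) ≥ (r + 1) * (2 * m₁ + 2 * m₂) := by nlinarith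
  have k2 : 2 * m₁ + 2 * m₂ ≥ 2 * (r + 2) + 8 + (x + y) := by omega
  have k3 := Nat.mul_le_mul_left (r + 1) k2
  have k4 : a₁ + a₂ + m₁ ≤ (r + 2) * (r + 2 + 2) := by omega
  nlinarith

end EvenGeo


set_option linter.unusedSectionVars false
set_option linter.deprecated false

namespace EvenGeo
open Module

variable {K : Type*} [Field K] [Finite K]

lemma charTwo (h : ℕ) (hq : Nat.card K = 2 ^ h) : CharP K 2 := by
  have : Fintype K := Fintype.ofFinite K
  obtain ⟨p, hp⟩ := CharP.exists K
  obtain ⟨n, hp1, hn⟩ := FiniteField.card K p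
  rw [Nat.card_eq_fintype_card, hn] at hq
  have h1 : p ∣ 2 ^ h := hq ▸ dvd_pow_self p n.ne_zero
  have h2 : p = 2 := (Nat.prime_dvd_prime_iff_eq hp1 Nat.prime_two).1 (hp1.dvd_of_dvd_pow h1)
  exact h2 ▸ hp

lemma part2 (h : ℕ) (hq : Nat.card K = 2 ^ h) {S : Set (PGPoint K 3)} (hE : IsEvenType S)
    (hcard : S.ncard = Nat.card K * (Nat.card K + 2)) (hnot : ¬ IsHypercylinder S)
    (L : Submodule K (V K)) (hL : finrank K L = 2) (hm : Nat.card K < 2 * cnt S L) :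
    cnt S L < Nat.card K ∧ 2 * Nat.card K + 4 ≤ 3 * cnt S L ∧
    ∃ e : ℕ, e ∣ h ∧ 2 < 2 ^ e ∧ 2 ^ e < Nat.card K ∧
        Nat.card K + 1 - (Nat.card K - 1) / (2 ^ e - 1) ≤ cnt S L ∧
        cnt S L ≤ Nat.card K - Nat.card K / 2 ^ e := by
  have hchar := charTwo h hq
  have hq1 := one_lt_q (K := K)
  have hlt : cnt S L < Nat.card K :=
    lt_of_le_of_ne (line_le hE hcard L hL) (fun hc => hnot (hyper hE hcard L hL hc))
  obtain ⟨e, he1, he2, he3, he4, he5⟩ := tight_planar h hq hE hcard L hL (by omega) hlt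
  have hene : e ≠ 1 := by
    rintro rfl
    rw [pow_one] at he4
    have hh : h ≠ 0 := by
      rintro rfl
      rw [hq, pow_zero] at hq1
      exact lt_irrefl _ hq1
    obtain ⟨z, hz⟩ : Even (Nat.card K) := by
      rw [hq]; exact Nat.even_pow.2 ⟨even_two, hh⟩
    omega
  have h4 : 2 ^ 2 ≤ 2 ^ e := Nat.pow_le_pow_right (by norm_num) (by omega)
  refine ⟨hlt, ?_, e, he1, by omega, he3, ?_, ?_⟩
  · have := Nat.mul_le_mul_left (Nat.card K + 1 - cnt S L) (by omega : 3 ≤ 2 ^ e - 1)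
    omega
  · have := (Nat.le_div_iff_mul_le (by omega : 0 < 2 ^ e - 1)).2 he5
    omega
  · omega

end EvenGeo

/-- Let `q = 2^h` and let `S` be a set of even type of size
`q(q+2)` in `PG(3,q)` which is not a hypercylinder.  Then there is at most one
line `ℓ` with `|ℓ ∩ S| > q/2`, and for any such line there is a divisor `e` of
`h` with `s = 2^e`, `2 < s < q`, such that
`q + 1 - (q-1)/(s-1) ≤ |ℓ ∩ S| ≤ q - q/s`. -/
theorem stmt6 {K : Type*} [Field K] [Finite K] (h : ℕ)
    (hq : Nat.card K = 2 ^ h)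
    (S : Set (PGPoint K 3)) (hS : IsEvenType S)
    (hcard : S.ncard = Nat.card K * (Nat.card K + 2))
    (hnot : ¬ IsHypercylinder S) :
    (∀ ℓ₁ ℓ₂ : Set (PGPoint K 3), IsKSpace 1 ℓ₁ → IsKSpace 1 ℓ₂ →
      Nat.card K < 2 * (ℓ₁ ∩ S).ncard → Nat.card K < 2 * (ℓ₂ ∩ S).ncard →
      ℓ₁ = ℓ₂) ∧
    (∀ ℓ : Set (PGPoint K 3), IsKSpace 1 ℓ →
      Nat.card K < 2 * (ℓ ∩ S).ncard →
      ∃ e : ℕ, e ∣ h ∧ 2 < 2 ^ e ∧ 2 ^ e < Nat.card K ∧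
        Nat.card K + 1 - (Nat.card K - 1) / (2 ^ e - 1) ≤ (ℓ ∩ S).ncard ∧
        (ℓ ∩ S).ncard ≤ Nat.card K - Nat.card K / 2 ^ e) := by
  constructor
  · rintro _ _ ⟨L₁, hL₁, rfl⟩ ⟨L₂, hL₂, rfl⟩ h₁ h₂
    rw [Set.inter_comm] at h₁ h₂
    obtain ⟨a1, a2, -⟩ := EvenGeo.part2 h hq hS hcard hnot L₁ hL₁ h₁
    obtain ⟨b1, b2, -⟩ := EvenGeo.part2 h hq hS hcard hnot L₂ hL₂ h₂
    have hq1 := EvenGeo.one_lt_q (K := K)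
    have hev : Even (Nat.card K) := by
      rw [hq]
      apply Nat.even_pow.2
      refine ⟨even_two, ?_⟩
      rintro rfl
      rw [hq, pow_zero] at hq1
      exact lt_irrefl _ hq1
    by_contra hne
    have hne' : L₁ ≠ L₂ := by rintro rfl; exact hne rfl
    by_cases hsk : ∀ X : PGPoint K 3, X.sp ≤ L₁ → ¬ X.sp ≤ L₂
    · exact EvenGeo.skew hS hev hcard L₁ L₂ hL₁ hL₂ hsk a2 b2
    · push Not at hsk
      obtain ⟨Q, hQ1, hQ2⟩ := hsk
      exact EvenGeo.cross hS hcard L₁ L₂ hL₁ hL₂ hne' Q hQ1 hQ2 a1 a2 b2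
  · rintro _ ⟨L, hL, rfl⟩ hm
    rw [Set.inter_comm] at hm ⊢
    exact (EvenGeo.part2 h hq hS hcard hnot L hL hm).2.2
end

section
/- Every set of even type of size 80 in PG(3,8) is a hypercylinder. -/
open Submodule

structure Geo {P : Type*} [Fintype P] [DecidableEq P] (Ls Ps : Finset (Finset P)) : Prop where
  cardP : Fintype.card P = 585
  cardL : ∀ l ∈ Ls, l.card = 9
  cardPl : ∀ a ∈ Ps, a.card = 73
  join : ∀ p q : P, p ≠ q → ∃ l ∈ Ls, p ∈ l ∧ q ∈ l
  uniq : ∀ l ∈ Ls, ∀ l' ∈ Ls, ∀ p q : P, p ≠ q → p ∈ l → q ∈ l → p ∈ l' → q ∈ l' → l = l'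
  span : ∀ l ∈ Ls, ∀ p : P, p ∉ l → ∃ a ∈ Ps, l ⊆ a ∧ p ∈ a
  spanu : ∀ l ∈ Ls, ∀ p : P, p ∉ l → ∀ a ∈ Ps, ∀ b ∈ Ps, l ⊆ a → p ∈ a → l ⊆ b → p ∈ b → a = b
  sub : ∀ a ∈ Ps, ∀ l ∈ Ls, ∀ p q : P, p ≠ q → p ∈ l → q ∈ l → p ∈ a → q ∈ a → l ⊆ a
  meetLP : ∀ l ∈ Ls, ∀ a ∈ Ps, ∃ p ∈ l, p ∈ a
  meetLL : ∀ a ∈ Ps, ∀ l ∈ Ls, ∀ l' ∈ Ls, l ⊆ a → l' ⊆ a → ∃ p ∈ l, p ∈ l'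

namespace Geo
open Finset
variable {P : Type*} [Fintype P] [DecidableEq P] {Ls Ps : Finset (Finset P)} {S : Finset P}

theorem pencil (G : Geo Ls Ps) (F : Finset P)
    (hF : ∀ l ∈ Ls, ∀ p q : P, p ≠ q → p ∈ l → q ∈ l → p ∈ F → q ∈ F → l ⊆ F)
    {p : P} (hp : p ∈ F) (T : Finset P) (hT : T ⊆ F) (hpT : p ∉ T) :
    ∑ l ∈ Ls with p ∈ l ∧ l ⊆ F, (T ∩ l).card = T.card := by
  rw [Finset.sum_card_inter (n := 1), mul_one]
  intro x hx
  have hne : p ≠ x := fun h => hpT (h ▸ hx)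
  obtain ⟨l, hl, hpl, hxl⟩ := G.join p x hne
  rw [card_eq_one]
  refine ⟨l, ?_⟩
  ext l'
  simp only [mem_filter, mem_singleton]
  constructor
  · rintro ⟨⟨h1, h2, h3⟩, h4⟩
    exact G.uniq _ h1 _ hl p x hne h2 h4 hpl hxl
  · rintro rfl
    exact ⟨⟨hl, hpl, hF _ hl p x hne hpl hxl hp (hT hx)⟩, hxl⟩

theorem pencil_card (G : Geo Ls Ps) (F : Finset P)
    (hF : ∀ l ∈ Ls, ∀ p q : P, p ≠ q → p ∈ l → q ∈ l → p ∈ F → q ∈ F → l ⊆ F)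
    {p : P} (hp : p ∈ F) {k : ℕ} (hk : F.card = 8 * k + 1) :
    (Ls.filter (fun l => p ∈ l ∧ l ⊆ F)).card = k := by
  have h := G.pencil F hF hp (F.erase p) (erase_subset _ _) (by simp)
  rw [card_erase_of_mem hp, sum_congr rfl (g := fun _ => 8)] at h
  · simp at h; omega
  · intro l hl
    simp only [mem_filter] at hl
    rw [erase_inter, inter_eq_right.2 hl.2.2, card_erase_of_mem hl.2.1, G.cardL l hl.1]

theorem excess (G : Geo Ls Ps) (hev : ∀ l ∈ Ls, Even (S ∩ l).card) (F : Finset P)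
    (hF : ∀ l ∈ Ls, ∀ p q : P, p ≠ q → p ∈ l → q ∈ l → p ∈ F → q ∈ F → l ⊆ F)
    {p : P} (hp : p ∈ F) (hpS : p ∈ S) {k : ℕ} (hk : F.card = 8 * k + 1) :
    ∑ l ∈ Ls with p ∈ l ∧ l ⊆ F, ((S ∩ l).card - 2) + (k + 1) = (S ∩ F).card := by
  have h := G.pencil F hF hp ((S ∩ F).erase p) ((erase_subset _ _).trans inter_subset_right)
    (by simp)
  have hpF : p ∈ S ∩ F := by simp [hp, hpS]
  have hc := G.pencil_card F hF hp hk
  have e : ∑ l ∈ Ls with p ∈ l ∧ l ⊆ F, (((S ∩ F).erase p) ∩ l).card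
      = ∑ l ∈ Ls with p ∈ l ∧ l ⊆ F, (((S ∩ l).card - 2) + 1) := by
    refine sum_congr rfl fun l hl => ?_
    simp only [mem_filter] at hl
    have h1 : ((S ∩ F).erase p) ∩ l = (S ∩ l).erase p := by
      ext x; simp only [mem_inter, mem_erase]
      have := @hl.2.2 x
      tauto
    have h2 : p ∈ S ∩ l := by simp [hpS, hl.2.1]
    rw [h1, card_erase_of_mem h2]
    have := card_pos.2 ⟨p, h2⟩
    obtain ⟨r, hr⟩ := hev l hl.1
    omega
  rw [e, sum_add_distrib, sum_const, hc, card_erase_of_mem hpF] at h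
  have := card_pos.2 ⟨p, hpF⟩
  simp at h; omega

theorem exU (G : Geo Ls Ps) (hev : ∀ l ∈ Ls, Even (S ∩ l).card) (h80 : S.card = 80)
    {p : P} (hpS : p ∈ S) : ∑ l ∈ Ls with p ∈ l, ((S ∩ l).card - 2) = 6 := by
  have := G.excess hev univ (by simp) (mem_univ p) hpS (k := 73) (by simp [G.cardP])
  simp [h80] at this
  exact this

theorem exP (G : Geo Ls Ps) (hev : ∀ l ∈ Ls, Even (S ∩ l).card) {a : Finset P} (ha : a ∈ Ps)
    {p : P} (hpS : p ∈ S) (hp : p ∈ a) :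
    ∑ l ∈ Ls with p ∈ l ∧ l ⊆ a, ((S ∩ l).card - 2) + 10 = (S ∩ a).card :=
  G.excess hev a (G.sub a ha) hp hpS (k := 9) (by simp [G.cardPl a ha])

theorem pl (G : Geo Ls Ps) {l : Finset P} (hl : l ∈ Ls) (T : Finset P) (hT : Disjoint T l) :
    ∑ a ∈ Ps with l ⊆ a, (T ∩ a).card = T.card := by
  rw [Finset.sum_card_inter (n := 1), mul_one]
  intro x hx
  have hxl : x ∉ l := Finset.disjoint_left.1 hT hx
  obtain ⟨a, ha, h1, h2⟩ := G.span l hl x hxl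
  rw [card_eq_one]
  refine ⟨a, ?_⟩
  ext b
  simp only [mem_filter, mem_singleton]
  constructor
  · rintro ⟨⟨h3, h4⟩, h5⟩
    exact G.spanu l hl x hxl b h3 a ha h4 h5 h1 h2
  · rintro rfl
    exact ⟨⟨ha, h1⟩, h2⟩

theorem pl_card (G : Geo Ls Ps) {l : Finset P} (hl : l ∈ Ls) :
    (Ps.filter (fun a => l ⊆ a)).card = 9 := by
  have h := G.pl hl (univ \ l) sdiff_disjoint
  rw [sum_congr rfl (g := fun _ => 64)] at h
  · rw [card_sdiff_of_subset (subset_univ _), card_univ, G.cardP, G.cardL l hl] at h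
    simp at h; omega
  · intro a ha
    simp only [mem_filter] at ha
    have : (univ \ l) ∩ a = a \ l := by ext; simp [and_comm]
    rw [this, card_sdiff_of_subset ha.2, G.cardPl a ha.1, G.cardL l hl]

theorem pl_sum (G : Geo Ls Ps) (h80 : S.card = 80) {l : Finset P} (hl : l ∈ Ls) :
    ∑ a ∈ Ps with l ⊆ a, (S ∩ a).card = 80 + 8 * (S ∩ l).card := by
  have h := G.pl hl (S \ l) sdiff_disjoint
  have h2 : ∑ a ∈ Ps with l ⊆ a, (S ∩ a).card
      = ∑ a ∈ Ps with l ⊆ a, (((S \ l) ∩ a).card + (S ∩ l).card) := by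
    refine sum_congr rfl fun a ha => ?_
    simp only [mem_filter] at ha
    rw [← card_union_of_disjoint]
    · congr 1; ext x; simp only [mem_inter, mem_union, mem_sdiff]
      have := @ha.2 x
      tauto
    · rw [disjoint_left]; simp only [mem_inter, mem_sdiff]; tauto
  rw [h2, sum_add_distrib, h, sum_const, G.pl_card hl]
  have := card_sdiff_add_card_inter S l
  simp; omega

/-- bound on two lines through a point -/
theorem two_le (G : Geo Ls Ps) (hev : ∀ l ∈ Ls, Even (S ∩ l).card) (h80 : S.card = 80)
    {p : P} (hpS : p ∈ S) {l m : Finset P} (hl : l ∈ Ls) (hm : m ∈ Ls) (hlm : l ≠ m)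
    (hpl : p ∈ l) (hpm : p ∈ m) : ((S ∩ l).card - 2) + ((S ∩ m).card - 2) ≤ 6 := by
  rw [← G.exU hev h80 hpS, ← sum_pair (f := fun l => (S ∩ l).card - 2) hlm]
  apply sum_le_sum_of_subset
  intro x; simp; rintro (rfl | rfl) <;> simp [*]

theorem le_eight (G : Geo Ls Ps) (hev : ∀ l ∈ Ls, Even (S ∩ l).card) (h80 : S.card = 80)
    {l : Finset P} (hl : l ∈ Ls) : (S ∩ l).card ≤ 8 := by
  rcases (S ∩ l).eq_empty_or_nonempty with h | ⟨p, hp⟩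
  · simp [h]
  · simp only [mem_inter] at hp
    have := G.exU hev h80 hp.1
    have h2 := single_le_sum (f := fun l => (S ∩ l).card - 2) (fun _ _ => Nat.zero_le _)
      (show l ∈ Ls.filter (fun l => p ∈ l) by simp [hl, hp.2])
    omega

theorem cone (G : Geo Ls Ps) (hev : ∀ l ∈ Ls, Even (S ∩ l).card) (h80 : S.card = 80)
    {l : Finset P} (hl : l ∈ Ls) (h8 : (S ∩ l).card = 8) :
    ∃ N, N ∉ S ∧ (∀ p ∈ S, ∀ m ∈ Ls, N ∈ m → p ∈ m → m.erase N ⊆ S) ∧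
      ∀ m ∈ Ls, N ∉ m → (S ∩ m).card ≤ 2 := by
  have h9 := G.cardL l hl
  -- the missing point
  have hN : (l \ S).card = 1 := by
    have := card_sdiff_add_card_inter l S
    rw [inter_comm] at this; omega
  obtain ⟨N, hN⟩ := card_eq_one.1 hN
  have hNl : N ∈ l \ S := by simp [hN]
  have hNu : ∀ x ∈ l, x ∉ S → x = N := fun x hx hxS => by
    have : x ∈ l \ S := by simp [hx, hxS]
    simpa [hN] using this
  simp only [mem_sdiff] at hNl
  -- key: secant through N
  have key : ∀ m ∈ Ls, N ∈ m → (S ∩ m).card = 8 → m.erase N ⊆ S := by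
    intro m hm hNm h
    have h1 : S ∩ m ⊆ m.erase N := by
      intro x; simp only [mem_inter, mem_erase]
      rintro ⟨h1, h2⟩
      exact ⟨fun h => hNl.2 (h ▸ h1), h2⟩
    have h2 := eq_of_subset_of_card_le h1 (by rw [card_erase_of_mem hNm, G.cardL m hm, h])
    rw [← h2]; exact inter_subset_left
  have key2 : ∀ p ∈ S, ∀ m ∈ Ls, N ∈ m → p ∈ m → (S ∩ m).card = 8 := by
    intro p hp m hm hNm hpm
    have hpN : p ≠ N := fun h => hNl.2 (h ▸ hp)
    by_cases hpl : p ∈ l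
    · rw [G.uniq m hm l hl p N hpN hpm hNm hpl hNl.1, h8]
    obtain ⟨a, ha, hla, hpa⟩ := G.span l hl p hpl
    -- T ⊆ m
    obtain ⟨R, hR⟩ : (S ∩ l).Nonempty := by rw [← card_pos]; omega
    simp only [mem_inter] at hR
    have e1 := G.exP hev ha hR.1 (hla hR.2)
    have h2 := single_le_sum (f := fun l => (S ∩ l).card - 2) (fun _ _ => Nat.zero_le _)
      (show l ∈ Ls.filter (fun l => R ∈ l ∧ l ⊆ a) by simp [hl, hR.2, hla])
    simp only [h8] at h2
    have hsub : (S ∩ a) \ l ⊆ S ∩ m := by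
      intro q
      simp only [mem_sdiff, mem_inter]
      rintro ⟨⟨hqS, hqa⟩, hql⟩
      refine ⟨hqS, ?_⟩
      by_cases hqp : q = p
      · exact hqp ▸ hpm
      obtain ⟨n, hn, hqn, hpn⟩ := G.join q p hqp
      have hna := G.sub a ha n hn q p hqp hqn hpn hqa hpa
      obtain ⟨R', hR'n, hR'l⟩ := G.meetLL a ha n hn l hl hna hla
      by_cases hR'S : R' ∈ S
      · exfalso
        have h3 := G.two_le hev h80 hR'S hl hn (fun h => hql (h ▸ hqn)) hR'l hR'n
        have h4 : 2 < (S ∩ n).card := by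
          rw [two_lt_card]
          refine ⟨q, by simp [*], p, by simp [*], R', by simp [*], hqp, ?_, ?_⟩
          · rintro rfl; exact hql hR'l
          · rintro rfl; exact hpl hR'l
        obtain ⟨r, hr⟩ := hev n hn
        omega
      · have := hNu R' hR'l hR'S
        subst this
        rw [G.uniq m hm n hn p R' hpN hpm hNm hpn hR'n]; exact hqn
    have h3 := card_le_card hsub
    have h4 : (S ∩ a) ∩ l = S ∩ l := by
      ext x; simp only [mem_inter]; have := @hla x; tauto
    have h5 := card_sdiff_add_card_inter (S ∩ a) l
    rw [h4] at h5
    have := G.le_eight hev h80 hm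
    omega
  refine ⟨N, hNl.2, fun p hp m hm h1 h2 => key m hm h1 (key2 p hp m hm h1 h2), ?_⟩
  intro m hm hNm
  rcases (S ∩ m).eq_empty_or_nonempty with h | ⟨p, hp⟩
  · simp [h]
  simp only [mem_inter] at hp
  obtain ⟨n, hn, hNn, hpn⟩ := G.join N p (fun h => hNm (h ▸ hp.2))
  have h1 := key2 p hp.1 n hn hNn hpn
  have h2 := G.two_le hev h80 hp.1 hn hm (fun h => hNm (h ▸ hNn)) hpn hp.2
  omega

theorem two_leP (G : Geo Ls Ps) (hev : ∀ l ∈ Ls, Even (S ∩ l).card)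
    {a : Finset P} (ha : a ∈ Ps)
    {p : P} (hpS : p ∈ S) {l m : Finset P} (hl : l ∈ Ls) (hm : m ∈ Ls) (hlm : l ≠ m)
    (hpl : p ∈ l) (hpm : p ∈ m) (hla : l ⊆ a) (hma : m ⊆ a) :
    ((S ∩ l).card - 2) + ((S ∩ m).card - 2) + 10 ≤ (S ∩ a).card := by
  rw [← G.exP hev ha hpS (hla hpl), ← sum_pair (f := fun l => (S ∩ l).card - 2) hlm]
  apply Nat.add_le_add_right
  apply sum_le_sum_of_subset
  intro x; simp; rintro (rfl | rfl) <;> simp [*]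

theorem one_leP (G : Geo Ls Ps) (hev : ∀ l ∈ Ls, Even (S ∩ l).card)
    {a : Finset P} (ha : a ∈ Ps)
    {p : P} (hpS : p ∈ S) {l : Finset P} (hl : l ∈ Ls)
    (hpl : p ∈ l) (hla : l ⊆ a) :
    ((S ∩ l).card - 2) + 10 ≤ (S ∩ a).card := by
  rw [← G.exP hev ha hpS (hla hpl)]
  apply Nat.add_le_add_right
  exact single_le_sum (f := fun l => (S ∩ l).card - 2) (fun _ _ => Nat.zero_le _)
      (show l ∈ Ls.filter (fun l => p ∈ l ∧ l ⊆ a) by simp [hl, hpl, hla])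

theorem evenP (G : Geo Ls Ps) (hev : ∀ l ∈ Ls, Even (S ∩ l).card)
    {a : Finset P} (ha : a ∈ Ps) : Even (S ∩ a).card := by
  rcases (S ∩ a).eq_empty_or_nonempty with h | ⟨p, hp⟩
  · simp [h]
  simp only [mem_inter] at hp
  rw [← G.exP hev ha hp.1 hp.2]
  refine Even.add ?_ (by decide)
  apply even_sum
  intro l hl
  simp only [mem_filter] at hl
  exact (hev l hl.1).tsub (by decide)

theorem inter_le (G : Geo Ls Ps) {l m : Finset P} (hl : l ∈ Ls) (hm : m ∈ Ls) (hlm : l ≠ m) :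
    (l ∩ m).card ≤ 1 := by
  rw [card_le_one]
  intro x hx y hy
  simp only [mem_inter] at hx hy
  by_contra h
  exact hlm (G.uniq l hl m hm x y h hx.1 hy.1 hx.2 hy.2)

theorem no6 (G : Geo Ls Ps) (hev : ∀ l ∈ Ls, Even (S ∩ l).card) (h80 : S.card = 80)
    {l : Finset P} (hl : l ∈ Ls) (h6 : (S ∩ l).card = 6) : False := by
  obtain ⟨p, hp⟩ : (S ∩ l).Nonempty := by rw [← card_pos]; omega
  simp only [mem_inter] at hp
  -- a plane of size 14
  obtain ⟨a, ha, hla, h14⟩ : ∃ a ∈ Ps, l ⊆ a ∧ (S ∩ a).card = 14 := by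
    by_contra! hcon
    have h1 := G.pl_sum h80 hl
    have h2 : ∑ a ∈ Ps with l ⊆ a, 16 ≤ ∑ a ∈ Ps with l ⊆ a, (S ∩ a).card := by
      apply sum_le_sum
      intro a ha
      simp only [mem_filter] at ha
      have h3 := G.one_leP hev ha.1 hp.1 hl hp.2 ha.2
      have h4 := hcon a ha.1 ha.2
      obtain ⟨r, hr⟩ := G.evenP hev ha.1
      omega
    rw [sum_const, G.pl_card hl, h1, h6] at h2
    simp at h2
  set T := (S ∩ a) \ l with hTdef
  have hT : T.card = 8 := by
    have h4 : (S ∩ a) ∩ l = S ∩ l := by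
      ext x; simp only [mem_inter]; have := @hla x; tauto
    have h5 := card_sdiff_add_card_inter (S ∩ a) l
    rw [h4, ← hTdef] at h5
    omega
  -- heavy lines live in T
  have hsub : ∀ n ∈ Ls, n ⊆ a → n ≠ l → 4 ≤ (S ∩ n).card → S ∩ n ⊆ T := by
    intro n hn hna hnl h4 x hx
    simp only [mem_inter] at hx
    simp only [hTdef, mem_sdiff, mem_inter]
    refine ⟨⟨hx.1, hna hx.2⟩, fun hxl => ?_⟩
    have := G.two_leP hev ha hx.1 hl hn (Ne.symm hnl) hxl hx.2 hla hna
    omega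
  have hheavy : ∀ Q ∈ T, ∃ n ∈ Ls, n ⊆ a ∧ n ≠ l ∧ Q ∈ n ∧ 4 ≤ (S ∩ n).card ∧
      ((S ∩ n).card = 6 ∨ ∃ n' ∈ Ls, n' ⊆ a ∧ n' ≠ l ∧ n ≠ n' ∧ Q ∈ n' ∧ (S ∩ n).card = 4 ∧
        (S ∩ n').card = 4) := by
    intro Q hQ
    simp only [hTdef, mem_sdiff, mem_inter] at hQ
    have hs := G.exP hev ha hQ.1.1 hQ.1.2
    rw [h14] at hs
    obtain ⟨n, hn, hn0⟩ := exists_ne_zero_of_sum_ne_zero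
      (show ∑ l ∈ Ls with Q ∈ l ∧ l ⊆ a, ((S ∩ l).card - 2) ≠ 0 by omega)
    have hs2 := add_sum_erase _ (fun l => (S ∩ l).card - 2) hn
    simp only [mem_filter] at hn
    have hev1 := hev n hn.1
    have hnl : n ≠ l := fun h => hQ.2 (h ▸ hn.2.1)
    obtain ⟨r, hr⟩ := hev1
    refine ⟨n, hn.1, hn.2.2, hnl, hn.2.1, by omega, ?_⟩
    by_cases h : (S ∩ n).card = 6
    · exact Or.inl h
    right
    obtain ⟨n', hn', hn0'⟩ := exists_ne_zero_of_sum_ne_zero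
      (show ∑ l ∈ (Ls.filter (fun l => Q ∈ l ∧ l ⊆ a)).erase n, ((S ∩ l).card - 2) ≠ 0 by omega)
    simp only [mem_erase, mem_filter] at hn'
    have h2 := G.two_leP hev ha hQ.1.1 hn.1 hn'.2.1 (Ne.symm hn'.1) hn.2.1 hn'.2.2.1 hn.2.2 hn'.2.2.2
    obtain ⟨r', hr'⟩ := hev n' hn'.2.1
    exact ⟨n', hn'.2.1, hn'.2.2.2, fun h => hQ.2 (h ▸ hn'.2.2.1), Ne.symm hn'.1, hn'.2.2.1,
      by omega, by omega⟩
  obtain ⟨Q, hQ⟩ : T.Nonempty := by rw [← card_pos]; omega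
  obtain ⟨n, hn, hna, hnl, hQn, h4, h | ⟨n', hn', hna', hnl', hnn, hQn', h4n, h4n'⟩⟩ := hheavy Q hQ
  · have hs := hsub n hn hna hnl h4
    have hc : (T \ (S ∩ n)).card = 2 := by rw [card_sdiff_of_subset hs]; omega
    obtain ⟨R, hR⟩ : (T \ (S ∩ n)).Nonempty := by rw [← card_pos]; omega
    have hRT := (mem_sdiff.1 hR)
    obtain ⟨c, hcL, hca, hcl, hRc, hc4, -⟩ := hheavy R hRT.1
    have hcs := hsub c hcL hca hcl hc4
    have hcn : c ≠ n := by
      rintro rfl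
      have : R ∈ S := by have := hRT.1; simp only [hTdef, mem_sdiff, mem_inter] at this; tauto
      exact hRT.2 (by simp [this, hRc])
    have h1 : S ∩ c ⊆ (T \ (S ∩ n)) ∪ (c ∩ n) := by
      intro x hx
      have := hcs hx
      simp only [mem_inter, mem_union, mem_sdiff] at hx ⊢
      tauto
    have h2 := (card_le_card h1).trans (card_union_le _ _)
    have := G.inter_le hcL hn hcn
    omega
  · have hs := hsub n hn hna hnl h4
    have hs' := hsub n' hn' hna' hnl' (by omega)
    have hQS : Q ∈ S := by simp only [hTdef, mem_sdiff, mem_inter] at hQ; tauto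
    have hi1 : (S ∩ n ∩ (S ∩ n')).card ≤ 1 :=
      (card_le_card (by intro x; simp only [mem_inter]; tauto)).trans (G.inter_le hn hn' hnn)
    have hi2 : 0 < (S ∩ n ∩ (S ∩ n')).card := card_pos.2 ⟨Q, by simp [*]⟩
    have hu := card_union_add_card_inter (S ∩ n) (S ∩ n')
    have hc : (T \ (S ∩ n ∪ S ∩ n')).card = 1 := by
      rw [card_sdiff_of_subset (union_subset hs hs')]; omega
    obtain ⟨R, hR⟩ : (T \ (S ∩ n ∪ S ∩ n')).Nonempty := by rw [← card_pos]; omega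
    have hRT := (mem_sdiff.1 hR)
    have hRS : R ∈ S := by have := hRT.1; simp only [hTdef, mem_sdiff, mem_inter] at this; tauto
    obtain ⟨c, hcL, hca, hcl, hRc, hc4, -⟩ := hheavy R hRT.1
    have hcs := hsub c hcL hca hcl hc4
    have hcn : c ≠ n := by
      rintro rfl
      exact hRT.2 (by simp [hRS, hRc])
    have hcn' : c ≠ n' := by
      rintro rfl
      exact hRT.2 (by simp [hRS, hRc])
    have h1 : S ∩ c ⊆ (T \ (S ∩ n ∪ S ∩ n')) ∪ ((c ∩ n) ∪ (c ∩ n')) := by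
      intro x hx
      have := hcs hx
      simp only [mem_inter, mem_union, mem_sdiff] at hx ⊢
      tauto
    have h2 := (card_le_card h1).trans (card_union_le _ _)
    have h3 := card_union_le (c ∩ n) (c ∩ n')
    have := G.inter_le hcL hn hcn
    have := G.inter_le hcL hn' hcn'
    omega

/-- the 4-secants -/
def Q4 (Ls : Finset (Finset P)) (S : Finset P) : Finset (Finset P) :=
  Ls.filter (fun l => (S ∩ l).card = 4)

theorem sum_to_card (B : Finset (Finset P)) (hBL : B ⊆ Ls)
    (h4 : ∀ l ∈ Ls, (S ∩ l).card - 2 = if (S ∩ l).card = 4 then 2 else 0) :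
    ∑ l ∈ B, ((S ∩ l).card - 2) = 2 * (B.filter (fun l => (S ∩ l).card = 4)).card := by
  rw [sum_congr rfl (fun l hl => h4 l (hBL hl)), ← sum_filter, sum_const, smul_eq_mul, mul_comm]

theorem n4P (G : Geo Ls Ps) (hev : ∀ l ∈ Ls, Even (S ∩ l).card)
    (h4 : ∀ l ∈ Ls, (S ∩ l).card - 2 = if (S ∩ l).card = 4 then 2 else 0)
    {a : Finset P} (ha : a ∈ Ps) {p : P} (hpS : p ∈ S) (hp : p ∈ a) :
    2 * ((Q4 Ls S).filter (fun l => l ⊆ a ∧ p ∈ l)).card + 10 = (S ∩ a).card := by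
  rw [← G.exP hev ha hpS hp, sum_to_card _ (filter_subset _ _) h4]
  congr 3
  ext l; simp only [Q4, mem_filter]; tauto

theorem n4U (G : Geo Ls Ps) (hev : ∀ l ∈ Ls, Even (S ∩ l).card) (h80 : S.card = 80)
    (h4 : ∀ l ∈ Ls, (S ∩ l).card - 2 = if (S ∩ l).card = 4 then 2 else 0)
    {p : P} (hpS : p ∈ S) :
    ((Q4 Ls S).filter (fun l => p ∈ l)).card = 3 := by
  have h := G.exU hev h80 hpS
  rw [sum_to_card _ (filter_subset _ _) h4] at h
  have e : (Q4 Ls S).filter (fun l => p ∈ l) =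
      (Ls.filter (fun l => p ∈ l)).filter (fun l => (S ∩ l).card = 4) := by
    ext l; simp only [Q4, mem_filter]; tauto
  rw [e]; omega

theorem n4tot (G : Geo Ls Ps) (hev : ∀ l ∈ Ls, Even (S ∩ l).card) (h80 : S.card = 80)
    (h4 : ∀ l ∈ Ls, (S ∩ l).card - 2 = if (S ∩ l).card = 4 then 2 else 0) :
    (Q4 Ls S).card = 60 := by
  have h := sum_card_inter (s := S) (B := Q4 Ls S) (n := 3) (fun p hp => G.n4U hev h80 h4 hp)
  rw [sum_congr rfl (g := fun _ => 4)] at h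
  · simp [h80] at h; omega
  · intro l hl; exact (mem_filter.1 hl).2

theorem n4a (G : Geo Ls Ps) (hev : ∀ l ∈ Ls, Even (S ∩ l).card)
    (h4 : ∀ l ∈ Ls, (S ∩ l).card - 2 = if (S ∩ l).card = 4 then 2 else 0)
    {a : Finset P} (ha : a ∈ Ps) :
    4 * ((Q4 Ls S).filter (fun l => l ⊆ a)).card = (S ∩ a).card * (((S ∩ a).card - 10) / 2) := by
  have h := sum_card_inter (s := S ∩ a) (B := (Q4 Ls S).filter (fun l => l ⊆ a))
    (n := ((S ∩ a).card - 10) / 2) (fun p hp => by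
      simp only [mem_inter] at hp
      have := G.n4P hev h4 ha hp.1 hp.2
      rw [filter_filter]; omega)
  rw [sum_congr rfl (g := fun _ => 4)] at h
  · rw [← h]; simp [mul_comm]
  · intro l hl
    simp only [Q4, mem_filter] at hl
    rw [inter_assoc, inter_eq_right.2 hl.2]
    exact hl.1.2

theorem sizes (G : Geo Ls Ps) (hev : ∀ l ∈ Ls, Even (S ∩ l).card) (h80 : S.card = 80)
    (h4 : ∀ l ∈ Ls, (S ∩ l).card - 2 = if (S ∩ l).card = 4 then 2 else 0)
    {a : Finset P} (ha : a ∈ Ps) : (S ∩ a).card = 0 ∨ (S ∩ a).card = 10 ∨ (S ∩ a).card = 12 ∨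
      (S ∩ a).card = 14 ∨ (S ∩ a).card = 16 := by
  rcases (S ∩ a).eq_empty_or_nonempty with h | ⟨p, hp⟩
  · simp [h]
  simp only [mem_inter] at hp
  have h1 := G.n4P hev h4 ha hp.1 hp.2
  have h2 := G.n4U hev h80 h4 hp.1
  have h3 : ((Q4 Ls S).filter (fun l => l ⊆ a ∧ p ∈ l)).card ≤
      ((Q4 Ls S).filter (fun l => p ∈ l)).card :=
    card_le_card (by intro x; simp only [mem_filter]; tauto)
  omega

theorem ge12 (G : Geo Ls Ps) (hev : ∀ l ∈ Ls, Even (S ∩ l).card)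
    {a l : Finset P} (ha : a ∈ Ps) (hl : l ∈ Q4 Ls S) (hla : l ⊆ a) : 12 ≤ (S ∩ a).card := by
  simp only [Q4, mem_filter] at hl
  obtain ⟨p, hp⟩ : (S ∩ l).Nonempty := by rw [← card_pos]; omega
  simp only [mem_inter] at hp
  have := G.one_leP hev ha hp.1 hl.1 hp.2 hla
  omega

theorem lsum (G : Geo Ls Ps) (hev : ∀ l ∈ Ls, Even (S ∩ l).card) (h80 : S.card = 80)
    {l : Finset P} (hl : l ∈ Q4 Ls S) : ∑ a ∈ Ps with l ⊆ a, ((S ∩ a).card - 12) = 4 := by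
  have hl' := hl
  simp only [Q4, mem_filter] at hl'
  have h := G.pl_sum h80 hl'.1
  have h2 : ∑ a ∈ Ps with l ⊆ a, (S ∩ a).card
      = ∑ a ∈ Ps with l ⊆ a, (((S ∩ a).card - 12) + 12) := by
    refine sum_congr rfl fun a ha => ?_
    simp only [mem_filter] at ha
    have := G.ge12 hev ha.1 hl ha.2
    omega
  rw [h2, sum_add_distrib, sum_const, G.pl_card hl'.1, hl'.2] at h
  simp at h; omega

theorem counts (G : Geo Ls Ps) (hev : ∀ l ∈ Ls, Even (S ∩ l).card) (h80 : S.card = 80)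
    (h4 : ∀ l ∈ Ls, (S ∩ l).card - 2 = if (S ∩ l).card = 4 then 2 else 0) :
    (Ps.filter (fun a => (S ∩ a).card = 14)).card = 0 ∧
    (Ps.filter (fun a => (S ∩ a).card = 16)).card = 5 := by
  have h1 : ∑ l ∈ Q4 Ls S, ∑ a ∈ Ps with l ⊆ a, ((S ∩ a).card - 12) = 240 := by
    rw [sum_congr rfl (fun l hl => G.lsum hev h80 hl), sum_const, G.n4tot hev h80 h4]; rfl
  rw [sum_comm' (t' := Ps) (s' := fun a => (Q4 Ls S).filter (fun l => l ⊆ a))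
    (by intro x y; simp only [mem_filter]; tauto)] at h1
  rw [sum_congr rfl (g := fun a => 14 * (if (S ∩ a).card = 14 then 1 else 0) +
    48 * (if (S ∩ a).card = 16 then 1 else 0))] at h1
  · rw [sum_add_distrib, ← mul_sum, ← mul_sum, ← card_filter, ← card_filter] at h1
    omega
  · intro a ha
    have h := G.n4a hev h4 ha
    rw [sum_const, smul_eq_mul]
    rcases G.sizes hev h80 h4 ha with e | e | e | e | e <;> rw [e] at h ⊢ <;> simp at h ⊢ <;> omega

theorem plane_eq (G : Geo Ls Ps) {l n a b : Finset P} (hl : l ∈ Ls) (hn : n ∈ Ls) (hne : l ≠ n)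
    (ha : a ∈ Ps) (hb : b ∈ Ps) (h1 : l ⊆ a) (h2 : n ⊆ a) (h3 : l ⊆ b) (h4 : n ⊆ b) : a = b := by
  obtain ⟨x, hx, hxl⟩ : ∃ x ∈ n, x ∉ l := by
    by_contra! h
    exact hne (eq_of_subset_of_card_le h (by rw [G.cardL l hl, G.cardL n hn])).symm
  exact G.spanu l hl x hxl a ha b hb h1 (h2 hx) h3 (h4 hx)

/-- The final configuration is impossible. -/
theorem no4 (G : Geo Ls Ps) (hev : ∀ l ∈ Ls, Even (S ∩ l).card) (h80 : S.card = 80)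
    (h4 : ∀ l ∈ Ls, (S ∩ l).card - 2 = if (S ∩ l).card = 4 then 2 else 0) : False := by
  obtain ⟨h14, h16⟩ := G.counts hev h80 h4
  have QL : ∀ l ∈ Q4 Ls S, l ∈ Ls := fun l hl => (mem_filter.1 hl).1
  have QS : ∀ l ∈ Q4 Ls S, (S ∩ l).card = 4 := fun l hl => (mem_filter.1 hl).2
  set H := Ps.filter (fun a => (S ∩ a).card = 16) with hH
  set M := Ps.filter (fun a => (S ∩ a).card = 12) with hM
  have HP : ∀ a ∈ H, a ∈ Ps := fun a ha => (mem_filter.1 ha).1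
  have HS : ∀ a ∈ H, (S ∩ a).card = 16 := fun a ha => (mem_filter.1 ha).2
  have MP : ∀ a ∈ M, a ∈ Ps := fun a ha => (mem_filter.1 ha).1
  have MS : ∀ a ∈ M, (S ∩ a).card = 12 := fun a ha => (mem_filter.1 ha).2
  have size : ∀ l ∈ Q4 Ls S, ∀ a ∈ Ps, l ⊆ a → (S ∩ a).card = 12 ∨ (S ∩ a).card = 16 := by
    intro l hl a ha hla
    have h1 := G.ge12 hev ha hl hla
    have h2 := G.sizes hev h80 h4 ha
    have h3 : (S ∩ a).card ≠ 14 := fun h => by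
      have : a ∈ Ps.filter (fun a => (S ∩ a).card = 14) := by simp [ha, h]
      rw [card_eq_zero.1 h14] at this
      simp at this
    omega
  have H1 : ∀ l ∈ Q4 Ls S, (H.filter (fun a => l ⊆ a)).card = 1 := by
    intro l hl
    have h := G.lsum hev h80 hl
    rw [sum_congr rfl (g := fun a => 4 * (if (S ∩ a).card = 16 then 1 else 0)), ← mul_sum,
      ← card_filter, filter_comm] at h
    · rw [hH]; omega
    · intro a ha
      simp only [mem_filter] at ha
      rcases size l hl a ha.1 ha.2 with e | e <;> simp [e]
  have M1 : ∀ l ∈ Q4 Ls S, (M.filter (fun a => l ⊆ a)).card = 8 := by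
    intro l hl
    have h := G.pl_card (QL l hl)
    have h1 := H1 l hl
    have e : Ps.filter (fun a => l ⊆ a) = M.filter (fun a => l ⊆ a) ∪ H.filter (fun a => l ⊆ a) := by
      ext a
      simp only [hM, hH, mem_filter, mem_union]
      constructor
      · rintro ⟨h1, h2⟩
        rcases size l hl a h1 h2 with e | e <;> simp [*]
      · tauto
    rw [e, card_union_of_disjoint, h1] at h
    · omega
    · rw [disjoint_left]; simp only [hM, hH, mem_filter]; rintro a ⟨⟨_, h⟩, _⟩ ⟨⟨_, h'⟩, _⟩; omega
  have HU : ∀ l ∈ Q4 Ls S, ∀ a ∈ H, ∀ b ∈ H, l ⊆ a → l ⊆ b → a = b := by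
    intro l hl a ha b hb h1 h2
    exact card_le_one.1 (H1 l hl).le a (mem_filter.2 ⟨ha, h1⟩) b (mem_filter.2 ⟨hb, h2⟩)
  have HE : ∀ l ∈ Q4 Ls S, ∃ a ∈ H, l ⊆ a := by
    intro l hl
    obtain ⟨a, ha⟩ : (H.filter (fun a => l ⊆ a)).Nonempty := by rw [← card_pos, H1 l hl]; simp
    exact ⟨a, (mem_filter.1 ha).1, (mem_filter.1 ha).2⟩
  have H2 : ∀ p ∈ S, ∀ a ∈ H, ∀ b ∈ H, p ∈ a → p ∈ b → a = b := by
    have aux : ∀ p ∈ S, ∀ a ∈ H, p ∈ a → (Q4 Ls S).filter (fun l => l ⊆ a ∧ p ∈ l) =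
        (Q4 Ls S).filter (fun l => p ∈ l) := by
      intro p hp a ha hpa
      apply eq_of_subset_of_card_le
      · intro x; simp only [mem_filter]; tauto
      · have h1 := G.n4P hev h4 (HP a ha) hp hpa
        have h2 := G.n4U hev h80 h4 hp
        have := HS a ha
        omega
    intro p hp a ha b hb hpa hpb
    obtain ⟨l, hl⟩ : ((Q4 Ls S).filter (fun l => p ∈ l)).Nonempty := by
      rw [← card_pos, G.n4U hev h80 h4 hp]; simp
    have h1 := hl
    have h2 := hl
    rw [← aux p hp a ha hpa, mem_filter] at h1
    rw [← aux p hp b hb hpb, mem_filter] at h2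
    exact HU l h1.1 a ha b hb h1.2.1 h2.2.1
  have H3 : ∀ a ∈ H, ((Q4 Ls S).filter (fun l => l ⊆ a)).card = 12 := by
    intro a ha
    have h := G.n4a hev h4 (HP a ha)
    rw [HS a ha] at h; omega
  have M3 : ∀ a ∈ M, ((Q4 Ls S).filter (fun l => l ⊆ a)).card = 3 := by
    intro a ha
    have h := G.n4a hev h4 (MP a ha)
    rw [MS a ha] at h; omega
  -- unique intersection point
  have meetU : ∀ l ∈ Ls, ∀ a ∈ Ps, ¬ l ⊆ a → ∀ x y, x ∈ l → x ∈ a → y ∈ l → y ∈ a → x = y := by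
    intro l hl a ha hla x y h1 h2 h3 h4
    by_contra h
    exact hla (G.sub a ha l hl x y h h1 h3 h2 h4)
  have Ele : ∀ a ∈ H, ∀ N, N ∉ S → ((Q4 Ls S).filter (fun l => l ⊆ a ∧ N ∈ l)).card ≤ 4 := by
    intro a ha N hN
    have h := sum_card_inter_le (s := S ∩ a) (B := (Q4 Ls S).filter (fun l => l ⊆ a ∧ N ∈ l))
      (n := 1) (fun p hp => by
        rw [card_le_one]
        intro l hl m hm
        simp only [mem_filter] at hl hm
        simp only [mem_inter] at hp
        exact G.uniq l (QL l hl.1.1) m (QL m hm.1.1) p N (fun h => hN (h ▸ hp.1)) hl.2 hl.1.2.2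
          hm.2 hm.1.2.2)
    rw [sum_congr rfl (g := fun _ => 4)] at h
    · simp [HS a ha] at h; omega
    · intro l hl
      simp only [mem_filter] at hl
      rw [inter_assoc, inter_eq_right.2 hl.2.1]
      exact QS l hl.1
  have E1 : ∀ l ∈ Q4 Ls S, ∀ a ∈ H, ¬ l ⊆ a → ∀ N, N ∈ l → N ∈ a →
      ((Q4 Ls S).filter (fun n => n ⊆ a ∧ N ∈ n)).card = 4 := by
    intro l hl a ha hla N hNl hNa
    obtain ⟨b, hb, hlb⟩ := HE l hl
    have Zle : ∀ c ∈ H.erase b, ((Q4 Ls S).filter (fun n => n ⊆ c ∧ ∃ x ∈ l, x ∈ n)).card ≤ 4 := by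
      intro c hc
      simp only [mem_erase] at hc
      have hlc : ¬ l ⊆ c := fun h => hc.1 (HU l hl c hc.2 b hb h hlb)
      obtain ⟨x, hxl, hxc⟩ := G.meetLP l (QL l hl) c (HP c hc.2)
      have hxS : x ∉ S := fun h => hc.1 (H2 x h c hc.2 b hb hxc (hlb hxl))
      refine (card_le_card ?_).trans (Ele c hc.2 x hxS)
      intro n
      simp only [mem_filter]
      rintro ⟨h1, h2, y, hy, hyn⟩
      rw [meetU l (QL l hl) c (HP c hc.2) hlc x y hxl hxc hy (h2 hyn)]
      exact ⟨h1, h2, hyn⟩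
    have hY : ((M.filter (fun a => l ⊆ a)).biUnion
        (fun α => ((Q4 Ls S).filter (fun n => n ⊆ α)).erase l)).card = 16 := by
      rw [card_biUnion, sum_congr rfl (g := fun _ => 2), sum_const, M1 l hl]
      · rfl
      · intro α hα
        simp only [mem_filter] at hα
        rw [card_erase_of_mem (by simp [hl, hα.2]), M3 α hα.1]
      · intro α hα β hβ hne
        simp only [mem_coe, mem_filter] at hα hβ
        simp only [Function.onFun, disjoint_left, mem_erase, mem_filter]
        rintro n ⟨h1, h2, h3⟩ ⟨_, _, h4⟩
        exact hne (G.plane_eq (QL l hl) (QL n h2) (Ne.symm h1) (MP α hα.1) (MP β hβ.1) hα.2 h3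
          hβ.2 h4)
    have hsub : (M.filter (fun a => l ⊆ a)).biUnion
        (fun α => ((Q4 Ls S).filter (fun n => n ⊆ α)).erase l) ⊆
        (H.erase b).biUnion (fun c => (Q4 Ls S).filter (fun n => n ⊆ c ∧ ∃ x ∈ l, x ∈ n)) := by
      intro n
      simp only [mem_biUnion, mem_erase, mem_filter]
      rintro ⟨α, ⟨hα, hlα⟩, hnl, hn, hnα⟩
      obtain ⟨c, hc, hnc⟩ := HE n hn
      refine ⟨c, ⟨?_, hc⟩, hn, hnc, G.meetLL α (MP α hα) l (QL l hl) n (QL n hn) hlα hnα⟩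
      rintro rfl
      have := G.plane_eq (QL l hl) (QL n hn) (Ne.symm hnl) (MP α hα) (HP c hc) hlα hnα hlb hnc
      have h1 := MS α hα
      have h2 := HS c hc
      rw [this] at h1; omega
    have hle := (card_le_card hsub).trans card_biUnion_le
    rw [hY] at hle
    have hab : a ∈ H.erase b := by
      simp only [mem_erase]
      exact ⟨fun h => hla (h ▸ hlb), ha⟩
    rw [← add_sum_erase _ _ hab] at hle
    have h2 := sum_le_card_nsmul ((H.erase b).erase a)
      (fun c => ((Q4 Ls S).filter (fun n => n ⊆ c ∧ ∃ x ∈ l, x ∈ n)).card) 4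
      (fun c hc => Zle c (mem_of_mem_erase hc))
    rw [card_erase_of_mem hab, card_erase_of_mem hb, h16] at h2
    have h3 := Zle a hab
    have h5 : (Q4 Ls S).filter (fun n => n ⊆ a ∧ ∃ x ∈ l, x ∈ n) =
        (Q4 Ls S).filter (fun n => n ⊆ a ∧ N ∈ n) := by
      ext n
      simp only [mem_filter]
      constructor
      · rintro ⟨h1, h2, y, hy, hyn⟩
        rw [meetU l (QL l hl) a (HP a ha) hla N y hNl hNa hy (h2 hyn)]
        exact ⟨h1, h2, hyn⟩
      · rintro ⟨h1, h2, h3⟩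
        exact ⟨h1, h2, N, hNl, h3⟩
    rw [h5] at hle h3
    simp only [smul_eq_mul] at h2
    omega
  have E2 : ∀ l ∈ Q4 Ls S, ∀ b ∈ H, l ⊆ b → ∀ a ∈ H, a ≠ b → ∀ N, N ∈ l → N ∈ a →
      ((Q4 Ls S).filter (fun n => n ⊆ b ∧ N ∈ n)).card = 4 := by
    intro l hl b hb hlb a ha hab N hNl hNa
    have h := E1 l hl a ha (fun h => hab (HU l hl a ha b hb h hlb)) N hNl hNa
    obtain ⟨n, hn⟩ : ((Q4 Ls S).filter (fun n => n ⊆ a ∧ N ∈ n)).Nonempty := by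
      rw [← card_pos]; omega
    simp only [mem_filter] at hn
    exact E1 n hn.1 b hb (fun h => hab (HU n hn.1 a ha b hb hn.2.1 h)) N hn.2.2 (hlb hNl)
  -- choose the configuration
  obtain ⟨l, hl⟩ : (Q4 Ls S).Nonempty := by rw [← card_pos, G.n4tot hev h80 h4]; simp
  obtain ⟨b, hb, hlb⟩ := HE l hl
  obtain ⟨a, ha⟩ : (H.erase b).Nonempty := by
    rw [← card_pos, card_erase_of_mem hb, h16]; simp
  simp only [mem_erase] at ha
  obtain ⟨N, hNl, hNa⟩ := G.meetLP l (QL l hl) a (HP a ha.2)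
  have hFb := E2 l hl b hb hlb a ha.2 ha.1 N hNl hNa
  have hall : ∀ c ∈ H, N ∈ c := by
    intro c hc
    by_contra hNc
    have hcb : c ≠ b := fun h => hNc (h ▸ hlb hNl)
    have hx : ∀ n : Finset P, ∃ x, n ∈ Ls → x ∈ n ∧ x ∈ c := by
      intro n
      by_cases hn : n ∈ Ls
      · obtain ⟨x, h1, h2⟩ := G.meetLP n hn c (HP c hc)
        exact ⟨x, fun _ => ⟨h1, h2⟩⟩
      · exact ⟨N, fun h => absurd h hn⟩
    choose x hx using hx
    have h1 : (((Q4 Ls S).filter (fun n => n ⊆ b ∧ N ∈ n)).biUnion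
        (fun n => (Q4 Ls S).filter (fun k => k ⊆ b ∧ x n ∈ k))).card = 16 := by
      rw [card_biUnion, sum_congr rfl (g := fun _ => 4), sum_const, hFb]
      · rfl
      · intro n hn
        simp only [mem_filter] at hn
        have := hx n (QL n hn.1)
        exact E2 n hn.1 b hb hn.2.1 c hc hcb (x n) this.1 this.2
      · intro n hn m hm hne
        simp only [mem_coe, mem_filter] at hn hm
        simp only [Function.onFun, disjoint_left, mem_filter]
        rintro k ⟨hk, hkb, h1⟩ ⟨_, _, h2⟩
        have hxn := hx n (QL n hn.1)
        have hxm := hx m (QL m hm.1)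
        have hxx : x n ≠ x m := by
          intro h
          have hxN : x n ≠ N := fun h => hNc (h ▸ hxn.2)
          exact hne (G.uniq n (QL n hn.1) m (QL m hm.1) (x n) N hxN hxn.1 hn.2.2
            (h ▸ hxm.1) hm.2.2)
        have hkc := G.sub c (HP c hc) k (QL k hk) (x n) (x m) hxx h1 h2 hxn.2 hxm.2
        exact hcb (HU k hk c hc b hb hkc hkb)
    have h2 := card_le_card (show (((Q4 Ls S).filter (fun n => n ⊆ b ∧ N ∈ n)).biUnion
        (fun n => (Q4 Ls S).filter (fun k => k ⊆ b ∧ x n ∈ k))) ⊆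
        (Q4 Ls S).filter (fun k => k ⊆ b) by
      intro k; simp only [mem_biUnion, mem_filter]; rintro ⟨_, _, h1, h2, _⟩; exact ⟨h1, h2⟩)
    rw [h1, H3 b hb] at h2
    omega
  have hF : ∀ c ∈ H, ((Q4 Ls S).filter (fun n => n ⊆ c ∧ N ∈ n)).card = 4 := by
    intro c hc
    by_cases hcb : c = b
    · rw [hcb]; exact hFb
    · exact E1 l hl c hc (fun h => hcb (HU l hl c hc b hb h hlb)) N hNl (hall c hc)
  have dc : ∀ (A : Finset (Finset P)) (k : ℕ),
      (∀ n ∈ Q4 Ls S, (A.filter (fun a => n ⊆ a)).card = k) →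
      ∑ c ∈ A, ((Q4 Ls S).filter (fun n => n ⊆ c ∧ N ∈ n)).card =
        ((Q4 Ls S).filter (fun n => N ∈ n)).card * k := by
    intro A k hk
    have e := sum_card_bipartiteAbove_eq_sum_card_bipartiteBelow
      (s := (Q4 Ls S).filter (fun n => N ∈ n)) (t := A) (fun n c => n ⊆ c)
    rw [sum_congr rfl (g := fun _ => k), sum_const, smul_eq_mul] at e
    · rw [e]
      refine sum_congr rfl fun c _ => ?_
      congr 1
      ext n; simp only [bipartiteBelow, mem_filter]; tauto
    · intro n hn
      exact hk n (mem_filter.1 hn).1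
  have t1 := dc H 1 H1
  rw [sum_congr rfl hF, sum_const, h16] at t1
  have t2 := dc M 8 M1
  have t3 : 3 ∣ ∑ c ∈ M, ((Q4 Ls S).filter (fun n => n ⊆ c ∧ N ∈ n)).card := by
    apply dvd_sum
    intro α hα
    rcases ((Q4 Ls S).filter (fun n => n ⊆ α ∧ N ∈ n)).eq_empty_or_nonempty with h | ⟨k, hk⟩
    · simp [h]
    simp only [mem_filter] at hk
    have : (Q4 Ls S).filter (fun n => n ⊆ α ∧ N ∈ n) = (Q4 Ls S).filter (fun n => n ⊆ α) := by
      ext n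
      simp only [mem_filter]
      refine ⟨by tauto, fun ⟨hn, hnα⟩ => ⟨hn, hnα, ?_⟩⟩
      by_cases hnk : n = k
      · rw [hnk]; exact hk.2.2
      obtain ⟨c, hc, hnc⟩ := HE n hn
      obtain ⟨x, hxn, hxk⟩ := G.meetLL α (MP α hα) n (QL n hn) k (QL k hk.1) hnα hk.2.1
      have hkc : ¬ k ⊆ c := by
        intro h
        have := G.plane_eq (QL n hn) (QL k hk.1) hnk (MP α hα) (HP c hc) hnα hk.2.1 hnc h
        have h1 := MS α hα
        have h2 := HS c hc
        rw [this] at h1; omega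
      rw [meetU k (QL k hk.1) c (HP c hc) hkc N x hk.2.2 (hall c hc) hxk (hnc hxn)]
      exact hxn
    rw [this, M3 α hα]
  rw [t2] at t3
  simp only [smul_eq_mul] at t1
  omega

theorem main (G : Geo Ls Ps) (hev : ∀ l ∈ Ls, Even (S ∩ l).card) (h80 : S.card = 80) :
    ∃ N, N ∉ S ∧ (∀ p ∈ S, ∀ m ∈ Ls, N ∈ m → p ∈ m → m.erase N ⊆ S) ∧
      (∀ m ∈ Ls, N ∉ m → (S ∩ m).card ≤ 2) ∧ ∀ a ∈ Ps, N ∉ a → (S ∩ a).card = 10 := by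
  by_cases h : ∃ l ∈ Ls, (S ∩ l).card = 8
  · obtain ⟨l, hl, h8⟩ := h
    obtain ⟨N, h1, h2, h3⟩ := G.cone hev h80 hl h8
    refine ⟨N, h1, h2, h3, fun a ha hNa => ?_⟩
    obtain ⟨p, hp⟩ : S.Nonempty := by rw [← card_pos]; omega
    obtain ⟨m, hm, hNm, hpm⟩ := G.join N p (fun h => h1 (h ▸ hp))
    obtain ⟨q, hqm, hqa⟩ := G.meetLP m hm a ha
    have hqS : q ∈ S := h2 p hp m hm hNm hpm (by
      simp only [mem_erase]; exact ⟨fun h => hNa (h ▸ hqa), hqm⟩)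
    rw [← G.exP hev ha hqS hqa, sum_eq_zero]
    intro n hn
    simp only [mem_filter] at hn
    have := h3 n hn.1 (fun h => hNa (hn.2.2 h))
    omega
  · exfalso
    push Not at h
    refine G.no4 hev h80 fun l hl => ?_
    have h1 := h l hl
    have h2 : (S ∩ l).card ≠ 6 := fun h => G.no6 hev h80 hl h
    have h3 := G.le_eight hev h80 hl
    obtain ⟨r, hr⟩ := hev l hl
    split_ifs <;> omega

end Geo

section Linear
variable {K : Type*} [Field K] {n : ℕ}

theorem pg_finite [Finite K] : Finite (PGPoint K n) := by
  have : Finite (Submodule K (Fin (n + 1) → K)) :=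
    Finite.of_injective (fun W => (W : Set (Fin (n + 1) → K))) SetLike.coe_injective
  unfold PGPoint
  infer_instance

theorem pg_le_eq {p q : PGPoint K n} (h : p.1 ≤ q.1) : p = q :=
  Subtype.ext (Submodule.eq_of_le_of_finrank_eq h (p.2.trans q.2.symm))

theorem finrank_sup_pt (W : Submodule K (Fin (n + 1) → K)) (p : PGPoint K n) (h : ¬ p.1 ≤ W) :
    Module.finrank K ↥(W ⊔ p.1) = Module.finrank K W + 1 := by
  have h1 := Submodule.finrank_sup_add_finrank_inf_eq W p.1
  have h2 : Module.finrank K ↥(W ⊓ p.1) < Module.finrank K p.1 :=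
    Submodule.finrank_lt_finrank_of_lt (lt_of_le_of_ne inf_le_right fun e => h (inf_eq_right.1 e))
  have := p.2
  omega

theorem exists_pt (W : Submodule K (Fin (n + 1) → K)) (h : W ≠ ⊥) : ∃ p : PGPoint K n, p.1 ≤ W := by
  obtain ⟨v, hv, h0⟩ := Submodule.exists_mem_ne_zero_of_ne_bot h
  exact ⟨⟨K ∙ v, finrank_span_singleton h0⟩, by simpa using hv⟩

theorem meet_pt (W₁ W₂ U : Submodule K (Fin (n + 1) → K)) (h1 : W₁ ≤ U) (h2 : W₂ ≤ U)
    (h : Module.finrank K U < Module.finrank K W₁ + Module.finrank K W₂) :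
    ∃ p : PGPoint K n, p.1 ≤ W₁ ∧ p.1 ≤ W₂ := by
  have e := Submodule.finrank_sup_add_finrank_inf_eq W₁ W₂
  have e2 := Submodule.finrank_mono (sup_le h1 h2)
  obtain ⟨p, hp⟩ := exists_pt (W₁ ⊓ W₂) (by
    intro e3
    rw [e3, finrank_bot] at e
    omega)
  exact ⟨p, hp.trans inf_le_left, hp.trans inf_le_right⟩

theorem card_pts [Finite K] (W : Submodule K (Fin (n + 1) → K)) :
    (pts W).ncard = ∑ i ∈ Finset.range (Module.finrank K W), Nat.card K ^ i := by
  rw [← Projectivization.card_of_finrank K W rfl]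
  rw [← Nat.card_coe_set_eq]
  refine Nat.card_congr (Equiv.trans ?_ (Projectivization.equivSubmodule K W).symm)
  refine ⟨fun P => ⟨P.1.1.comap W.subtype, ?_⟩, fun H => ⟨⟨H.1.map W.subtype, ?_⟩, ?_⟩, ?_, ?_⟩
  · exact (Submodule.comapSubtypeEquivOfLe P.2).finrank_eq.trans P.1.2
  · exact (Submodule.finrank_map_subtype_eq W H.1).trans H.2
  · exact Submodule.map_subtype_le _ _
  · intro P
    apply Subtype.ext; apply Subtype.ext
    simp [Submodule.map_comap_subtype]
    exact P.2
  · intro H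
    apply Subtype.ext
    simp
    exact Submodule.comap_map_eq_of_injective W.injective_subtype _

end Linear

section Final
open Classical

/-- finset of points of a subspace -/
noncomputable def fpts {K : Type*} [Field K] {n : ℕ} [Fintype (PGPoint K n)]
    (W : Submodule K (Fin (n + 1) → K)) : Finset (PGPoint K n) :=
  Finset.univ.filter (fun p => p.1 ≤ W)

theorem mem_fpts {K : Type*} [Field K] {n : ℕ} [Fintype (PGPoint K n)]
    (W : Submodule K (Fin (n + 1) → K)) (p : PGPoint K n) : p ∈ fpts W ↔ p.1 ≤ W := by
  simp [fpts]

theorem coe_fpts {K : Type*} [Field K] {n : ℕ} [Fintype (PGPoint K n)]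
    (W : Submodule K (Fin (n + 1) → K)) : (fpts W : Set (PGPoint K n)) = pts W := by
  ext p; simp [fpts, pts]

/-- all subspaces of a given rank -/
noncomputable def flats (K : Type*) [Field K] (n : ℕ) [Fintype (PGPoint K n)] (k : ℕ) :
    Finset (Finset (PGPoint K n)) :=
  Finset.univ.filter
    (fun s => ∃ W : Submodule K (Fin (n + 1) → K), Module.finrank K W = k ∧ s = fpts W)

theorem mem_flats {K : Type*} [Field K] {n : ℕ} [Fintype (PGPoint K n)] {k : ℕ}
    {s : Finset (PGPoint K n)} : s ∈ flats K n k ↔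
      ∃ W : Submodule K (Fin (n + 1) → K), Module.finrank K W = k ∧ s = fpts W := by
  simp [flats]

theorem fpts_sub {K : Type*} [Field K] {n : ℕ} [Fintype (PGPoint K n)]
    {W U : Submodule K (Fin (n + 1) → K)} (h : fpts W ⊆ fpts U) : W ≤ U := by
  intro v hv
  by_cases h0 : v = 0
  · rw [h0]; exact U.zero_mem
  obtain ⟨p, hp⟩ : ∃ p : PGPoint K n, p.1 = K ∙ v := ⟨⟨K ∙ v, finrank_span_singleton h0⟩, rfl⟩
  have h1 : p ∈ fpts W := by
    rw [mem_fpts, hp]; simpa using hv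
  have h2 := h h1
  rw [mem_fpts, hp] at h2
  simpa using h2

theorem fpts_card {K : Type*} [Field K] {n : ℕ} [Finite K] [Fintype (PGPoint K n)]
    (W : Submodule K (Fin (n + 1) → K)) :
    (fpts W).card = ∑ i ∈ Finset.range (Module.finrank K W), Nat.card K ^ i := by
  rw [← card_pts, ← coe_fpts, Set.ncard_coe_finset]

theorem geoK {K : Type*} [Field K] [Finite K] (hK : Nat.card K = 8) [Fintype (PGPoint K 3)] :
    Geo (flats K 3 2) (flats K 3 3) where
  cardP := by
    have h := fpts_card (K := K) (n := 3) ⊤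
    have e : fpts (K := K) (n := 3) ⊤ = Finset.univ := by ext; simp [mem_fpts]
    rw [e, Finset.card_univ] at h
    simp [hK] at h
    rw [h]; decide
  cardL := by
    intro l hl
    obtain ⟨W, hW, rfl⟩ := mem_flats.1 hl
    rw [fpts_card, hW, hK]; decide
  cardPl := by
    intro l hl
    obtain ⟨W, hW, rfl⟩ := mem_flats.1 hl
    rw [fpts_card, hW, hK]; decide
  join := by
    intro p q hpq
    refine ⟨fpts (p.1 ⊔ q.1), mem_flats.2 ⟨_, ?_, rfl⟩, ?_, ?_⟩
    · rw [finrank_sup_pt p.1 q (fun h => hpq (pg_le_eq h).symm), p.2]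
    · rw [mem_fpts]; exact le_sup_left
    · rw [mem_fpts]; exact le_sup_right
  uniq := by
    intro l hl l' hl' p q hpq h1 h2 h3 h4
    obtain ⟨W, hW, rfl⟩ := mem_flats.1 hl
    obtain ⟨W', hW', rfl⟩ := mem_flats.1 hl'
    rw [mem_fpts] at h1 h2 h3 h4
    have e := finrank_sup_pt p.1 q (fun h => hpq (pg_le_eq h).symm)
    rw [p.2] at e
    rw [← Submodule.eq_of_le_of_finrank_eq (sup_le h1 h2) (by rw [e, hW]),
      ← Submodule.eq_of_le_of_finrank_eq (sup_le h3 h4) (by rw [e, hW'])]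
  span := by
    intro l hl p hp
    obtain ⟨W, hW, rfl⟩ := mem_flats.1 hl
    rw [mem_fpts] at hp
    refine ⟨fpts (W ⊔ p.1), mem_flats.2 ⟨_, ?_, rfl⟩, ?_, ?_⟩
    · rw [finrank_sup_pt W p hp, hW]
    · intro x; rw [mem_fpts, mem_fpts]; exact fun h => h.trans le_sup_left
    · rw [mem_fpts]; exact le_sup_right
  spanu := by
    intro l hl p hp a ha b hb h1 h2 h3 h4
    obtain ⟨W, hW, rfl⟩ := mem_flats.1 hl
    obtain ⟨A, hA, rfl⟩ := mem_flats.1 ha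
    obtain ⟨B, hB, rfl⟩ := mem_flats.1 hb
    rw [mem_fpts] at hp h2 h4
    have e := finrank_sup_pt W p hp
    rw [← Submodule.eq_of_le_of_finrank_eq (sup_le (fpts_sub h1) h2) (by rw [e, hW, hA]),
      ← Submodule.eq_of_le_of_finrank_eq (sup_le (fpts_sub h3) h4) (by rw [e, hW, hB])]
  sub := by
    intro a ha l hl p q hpq h1 h2 h3 h4
    obtain ⟨W, hW, rfl⟩ := mem_flats.1 hl
    obtain ⟨A, hA, rfl⟩ := mem_flats.1 ha
    rw [mem_fpts] at h1 h2 h3 h4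
    have e := finrank_sup_pt p.1 q (fun h => hpq (pg_le_eq h).symm)
    rw [p.2] at e
    rw [← Submodule.eq_of_le_of_finrank_eq (sup_le h1 h2) (by rw [e, hW])]
    intro x
    rw [mem_fpts, mem_fpts]
    exact fun h => h.trans (sup_le h3 h4)
  meetLP := by
    intro l hl a ha
    obtain ⟨W, hW, rfl⟩ := mem_flats.1 hl
    obtain ⟨A, hA, rfl⟩ := mem_flats.1 ha
    obtain ⟨p, h1, h2⟩ := meet_pt W A ⊤ le_top le_top (by simp [hW, hA])
    exact ⟨p, (mem_fpts _ _).2 h1, (mem_fpts _ _).2 h2⟩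
  meetLL := by
    intro a ha l hl l' hl' h1 h2
    obtain ⟨W, hW, rfl⟩ := mem_flats.1 hl
    obtain ⟨W', hW', rfl⟩ := mem_flats.1 hl'
    obtain ⟨A, hA, rfl⟩ := mem_flats.1 ha
    obtain ⟨p, h1, h2⟩ := meet_pt W W' A (fpts_sub h1) (fpts_sub h2) (by simp [hW, hW', hA])
    exact ⟨p, (mem_fpts _ _).2 h1, (mem_fpts _ _).2 h2⟩

theorem hyperK {K : Type*} [Field K] [Finite K] (hK : Nat.card K = 8) (S : Set (PGPoint K 3))
    (hS : IsEvenType S) (hcard : S.ncard = 80) : IsHypercylinder S := by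
  have : Finite (PGPoint K 3) := pg_finite
  have : Fintype (PGPoint K 3) := Fintype.ofFinite _
  have G := geoK hK
  have conv : ∀ W : Submodule K (Fin (3 + 1) → K),
      (S ∩ pts W).ncard = (S.toFinset ∩ fpts W).card := by
    intro W
    rw [← Set.ncard_coe_finset, Finset.coe_inter, Set.coe_toFinset, coe_fpts]
  obtain ⟨N, hN, h1, h2, h3⟩ := G.main (S := S.toFinset) (by
    intro l hl
    obtain ⟨W, hW, rfl⟩ := mem_flats.1 hl
    rw [← conv]
    exact hS _ ⟨W, hW, rfl⟩) (by rw [← Set.ncard_eq_toFinset_card']; exact hcard)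
  rw [Set.mem_toFinset] at hN
  obtain ⟨A, hA⟩ := Submodule.exists_isCompl N.1
  have hA3 : Module.finrank K A = 3 := by
    have := Submodule.finrank_add_eq_of_isCompl hA
    rw [N.2, Module.finrank_fin_fun] at this
    omega
  have hNA : ¬ N.1 ≤ A := by
    intro h
    have h5 := hA.disjoint.eq_bot
    rw [inf_eq_left.2 h] at h5
    have := N.2
    rw [h5, finrank_bot] at this
    omega
  have hAf : fpts A ∈ flats K 3 3 := mem_flats.2 ⟨A, hA3, rfl⟩
  have hline : ∀ Q : PGPoint K 3, Q ≠ N → fpts (Q.1 ⊔ N.1) ∈ flats K 3 2 := fun Q hQ =>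
    mem_flats.2 ⟨_, by rw [finrank_sup_pt Q.1 N (fun h => hQ (pg_le_eq h).symm), Q.2], rfl⟩
  refine ⟨A, N.1, S ∩ pts A, hA3, by rw [N.2], ?_, ⟨Set.inter_subset_right, ?_, ?_⟩, ?_⟩
  · rw [inf_comm]; exact hA.disjoint.eq_bot
  · rw [conv, hK, h3 _ hAf (by rwa [mem_fpts])]
  · rintro _ ⟨W, hW, rfl⟩
    by_cases hNW : N.1 ≤ W
    · have : ((S ∩ pts A) ∩ pts W).ncard ≤ 1 := by
        rw [Set.ncard_le_one (Set.toFinite _)]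
        rintro p ⟨⟨_, hp⟩, hp'⟩ q ⟨⟨_, hq⟩, hq'⟩
        by_contra hpq
        have := G.sub _ hAf (fpts W) (mem_flats.2 ⟨W, hW, rfl⟩) p q hpq ((mem_fpts _ _).2 hp')
          ((mem_fpts _ _).2 hq') ((mem_fpts _ _).2 hp) ((mem_fpts _ _).2 hq)
        exact hNA (hNW.trans (fpts_sub this))
      omega
    · refine (Set.ncard_le_ncard (t := S ∩ pts W) ?_ (Set.toFinite _)).trans ?_
      · rintro x ⟨⟨h, _⟩, h'⟩; exact ⟨h, h'⟩
      · rw [conv]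
        exact h2 _ (mem_flats.2 ⟨W, hW, rfl⟩) (by rwa [mem_fpts])
  · ext Q
    constructor
    · intro hQ
      have hQN : Q ≠ N := fun h => hN (h ▸ hQ)
      have hQl := hline Q hQN
      obtain ⟨p, hp1, hp2⟩ := G.meetLP _ hQl _ hAf
      have hpN : p ≠ N := by
        rintro rfl
        exact hNA ((mem_fpts _ _).1 hp2)
      have hNl : N ∈ fpts (Q.1 ⊔ N.1) := (mem_fpts _ _).2 le_sup_right
      have hpS := h1 Q (by simpa using hQ) _ hQl hNl
        ((mem_fpts _ _).2 le_sup_left) (Finset.mem_erase.2 ⟨hpN, hp1⟩)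
      rw [Set.mem_toFinset] at hpS
      refine ⟨⟨p, ⟨hpS, (mem_fpts _ _).1 hp2⟩, ?_⟩, fun h => hQN (pg_le_eq h)⟩
      have := G.uniq _ hQl _ (hline p hpN) p N hpN hp1 hNl ((mem_fpts _ _).2 le_sup_left)
        ((mem_fpts _ _).2 le_sup_right)
      rw [← mem_fpts, ← this, mem_fpts]
      exact le_sup_left
    · rintro ⟨⟨p, ⟨hpS, hpA⟩, hQ⟩, hQN⟩
      have hpN : p ≠ N := fun h => hN (h ▸ hpS)
      have := h1 p (by simpa using hpS) _ (hline p hpN) ((mem_fpts _ _).2 le_sup_right)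
        ((mem_fpts _ _).2 le_sup_left)
        (Finset.mem_erase.2 ⟨fun h => hQN (h ▸ le_refl _), (mem_fpts _ _).2 hQ⟩)
      simpa using this

end Final

/-- Every set of even type of size `80` in `PG(3,8)` is a
hypercylinder.  (Here `PG(3,8)` is built over the field `GaloisField 2 3`
of `8` elements.) -/
theorem stmt7 (S : Set (PGPoint (GaloisField 2 3) 3)) (hS : IsEvenType S)
    (hcard : S.ncard = 80) : IsHypercylinder S := by
  have : Finite (GaloisField 2 3) := inferInstance
  exact hyperK (by rw [GaloisField.card 2 3 (by decide)]; norm_num) S hS hcard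
end
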